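/- arXiv:1305.4291 — 3 statements merged into one kernel-verified Lean document; each statement's English description precedes it below -/
import Mathlib

section
/- For positive reals a, c with b := 1/2 − a − c > 0 and every real x, one has ψ̃_{a,c}(x) = e^{iπ/12} · ψ̄_{b,c}(−x); equivalently, ψ̄_{a,c}(x) = e^{−iπ/12} · ψ̃_{b,c}(−x). -/
open Real MeasureTheory

noncomputable section

/-- `c_𝖻 = i(𝖻 + 𝖻⁻¹)/2`. -/
def cB (bb : ℝ) : ℂ := Complex.I * (bb + bb⁻¹) / 2

/-- The integrand in the definition of Faddeev's quantum dilogarithm. -/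
def phiKer (bb : ℝ) (z w : ℂ) : ℂ :=
  Complex.exp (-2 * Complex.I * z * w) /
    (4 * Complex.sinh (w * bb) * Complex.sinh (w / bb) * w)

/-- Faddeev's quantum dilogarithm on the strip `|Im z| < Im c_𝖻`, defined by the
contour integral over `ℝ + iε` with `ε = π·min(𝖻,𝖻⁻¹)/2`. -/
def PhiS (bb : ℝ) (z : ℂ) : ℂ :=
  Complex.exp (∫ t : ℝ, phiKer bb z (t + Complex.I * (π * min bb bb⁻¹ / 2)))

/-- The factor appearing in the functional equation:
`Φ_𝖻(z) = Efac 𝖻 z · Φ_𝖻(z + i𝖻)`. -/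
def Efac (bb : ℝ) (z : ℂ) : ℂ := 1 + Complex.exp (2 * π * bb * (z + Complex.I * bb / 2))

/-- Number of upward shifts by `i𝖻` needed to bring `z` into the strip. -/
def nUp (bb : ℝ) (z : ℂ) : ℕ := ⌊(-((bb + bb⁻¹) / 2) - z.im) / bb⌋₊ + 1

/-- Number of downward shifts by `i𝖻` needed to bring `z` into the strip. -/
def nDn (bb : ℝ) (z : ℂ) : ℕ := ⌊(z.im - (bb + bb⁻¹) / 2) / bb⌋₊ + 1

/-- Faddeev's quantum dilogarithm `Φ_𝖻`, extended from the strip `|Im z| < Im c_𝖻`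
to all of `ℂ` as a meromorphic function by the functional equation
`Φ_𝖻(z - i𝖻/2) = (1 + e^{2π𝖻z}) Φ_𝖻(z + i𝖻/2)`. -/
def Phi (bb : ℝ) (z : ℂ) : ℂ :=
  if z.im ≤ -((bb + bb⁻¹) / 2) then
    (∏ k ∈ Finset.range (nUp bb z), Efac bb (z + Complex.I * k * bb)) *
      PhiS bb (z + Complex.I * (nUp bb z) * bb)
  else if (bb + bb⁻¹) / 2 ≤ z.im then
    PhiS bb (z - Complex.I * (nDn bb z) * bb) /
      ∏ k ∈ Finset.range (nDn bb z), Efac bb (z - Complex.I * (k + 1) * bb)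
  else PhiS bb z

/-- `ψ_{a,c}(t) = Φ_𝖻(t - 2c_𝖻(a+c))⁻¹ e^{-4πi c_𝖻 a (t - c_𝖻(a+c))} e^{-πi c_𝖻²(4(a-c)+1)/6}`. -/
def psiF (bb a c : ℝ) (t : ℂ) : ℂ :=
  (Phi bb (t - 2 * cB bb * (a + c)))⁻¹ *
    Complex.exp (-4 * π * Complex.I * cB bb * a * (t - cB bb * (a + c))) *
    Complex.exp (-π * Complex.I * (cB bb) ^ 2 * (4 * (a - c) + 1) / 6)

/-- `ψ̄_{a,c}(t) = Φ_𝖻(t + 2c_𝖻(a+c)) e^{-4πi c_𝖻 a (t + c_𝖻(a+c))} e^{πi c_𝖻²(4(a-c)+1)/6}`. -/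
def psiBar (bb a c : ℝ) (t : ℂ) : ℂ :=
  Phi bb (t + 2 * cB bb * (a + c)) *
    Complex.exp (-4 * π * Complex.I * cB bb * a * (t + cB bb * (a + c))) *
    Complex.exp (π * Complex.I * (cB bb) ^ 2 * (4 * (a - c) + 1) / 6)

/-- `ψ̃_{a,c}(s) = ∫_ℝ ψ_{a,c}(t) e^{-2πi s t} dt`. -/
def psiT (bb a c : ℝ) (s : ℝ) : ℂ :=
  ∫ t : ℝ, psiF bb a c t * Complex.exp (-2 * π * Complex.I * s * t)

/-- `ψ̃′_{a,c}(s) = e^{-πi s²} ψ̃_{a,c}(s)`. -/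
def psiT' (bb a c : ℝ) (s : ℝ) : ℂ :=
  Complex.exp (-π * Complex.I * s ^ 2) * psiT bb a c s

/-- `g_{a,c}(s,t) = Σ_{m∈ℤ} ψ̃′_{a,c}(s+m) e^{iπ t (s+2m)}`. -/
def gW (bb a c : ℝ) (s t : ℝ) : ℂ :=
  ∑' m : ℤ, psiT' bb a c (s + m) * Complex.exp (Complex.I * π * t * (s + 2 * m))

open Filter Topology Set

theorem integrable_exp_neg_mul_abs {δ : ℝ} (hδ : 0 < δ) :
    Integrable (fun x : ℝ => Real.exp (-δ * |x|)) := by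
  have h : IntegrableOn (fun x : ℝ => Real.exp (-δ * |x|)) (Ioi 0) :=
    (exp_neg_integrableOn_Ioi 0 hδ).congr_fun
      (fun x hx => by simp only [abs_of_pos (mem_Ioi.mp hx)]) measurableSet_Ioi
  rw [← integrableOn_univ, ← Iic_union_Ioi (a := (0 : ℝ)), integrableOn_union]
  refine ⟨?_, h⟩
  rw [integrableOn_Iic_iff_integrableOn_Iio, ← integrable_indicator_iff measurableSet_Iio]
  rw [← integrable_indicator_iff measurableSet_Ioi] at h
  refine h.comp_neg.congr (Eventually.of_forall fun x => ?_)
  simp [indicator, abs_neg]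

theorem integral_exp_neg_mul_abs {δ : ℝ} (hδ : 0 < δ) :
    ∫ x : ℝ, Real.exp (-δ * |x|) = 2 / δ := by
  rw [integral_comp_abs (f := fun x => Real.exp (-δ * x)), integral_exp_mul_Ioi (by linarith)]
  simp
  field_simp

/-- Cauchy's theorem on the strip `v₁ ≤ Im z ≤ v₂` for a function vanishing at infinity. -/
theorem tendsto_sub_integral_strip {f : ℂ → ℂ} {v₁ v₂ : ℝ} (hv : v₁ ≤ v₂)
    (hf : ∀ z : ℂ, v₁ ≤ z.im → z.im ≤ v₂ → DifferentiableAt ℂ f z)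
    {M : ℝ → ℝ} (hM : Tendsto M atTop (𝓝 0))
    (hfM : ∀ x v : ℝ, 1 ≤ |x| → v₁ ≤ v → v ≤ v₂ → ‖f (x + v * Complex.I)‖ ≤ M |x|) :
    Tendsto (fun T : ℝ => (∫ x : ℝ in -T..T, f (x + v₁ * Complex.I)) -
      ∫ x : ℝ in -T..T, f (x + v₂ * Complex.I)) atTop (𝓝 0) := by
  have hbd : ∀ T : ℝ, 1 ≤ T → ‖(∫ x : ℝ in -T..T, f (x + v₁ * Complex.I)) -
      ∫ x : ℝ in -T..T, f (x + v₂ * Complex.I)‖ ≤ 2 * (v₂ - v₁) * M T := by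
    intro T hT
    have h := Complex.integral_boundary_rect_eq_zero_of_differentiableOn f
      (⟨-T, v₁⟩ : ℂ) (⟨T, v₂⟩ : ℂ) (by
        intro z hz
        have h2 := (Complex.mem_reProdIm.mp hz).2
        simp only [uIcc_of_le hv, mem_Icc] at h2
        exact (hf z h2.1 h2.2).differentiableWithinAt)
    simp only [smul_eq_mul] at h
    have side : ∀ s : ℝ, |s| = T → ‖∫ y : ℝ in v₁..v₂, f (s + y * Complex.I)‖ ≤
        M T * (v₂ - v₁) := by
      intro s hs
      rw [← abs_of_nonneg (sub_nonneg.mpr hv)]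
      refine intervalIntegral.norm_integral_le_of_norm_le_const fun y hy => ?_
      rw [uIoc_of_le hv] at hy
      have := hfM s y (by rw [hs]; exact hT) hy.1.le hy.2
      rwa [hs] at this
    have e : (∫ x : ℝ in -T..T, f (x + v₁ * Complex.I)) -
      ∫ x : ℝ in -T..T, f (x + v₂ * Complex.I) =
        Complex.I * (∫ y : ℝ in v₁..v₂, f ((-T : ℝ) + y * Complex.I)) -
        Complex.I * (∫ y : ℝ in v₁..v₂, f ((T : ℝ) + y * Complex.I)) := by
      linear_combination h
    rw [e]
    refine (norm_sub_le _ _).trans ?_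
    rw [norm_mul, norm_mul, Complex.norm_I, one_mul, one_mul]
    have h1 := side (-T) (by rw [abs_neg, abs_of_nonneg (by linarith)])
    have h2 := side T (abs_of_nonneg (by linarith))
    linarith
  rw [tendsto_zero_iff_norm_tendsto_zero]
  refine squeeze_zero' (Eventually.of_forall fun _ => norm_nonneg _)
    ((eventually_ge_atTop 1).mono hbd) ?_
  simpa using hM.const_mul (2 * (v₂ - v₁))

theorem tendsto_exp_neg_mul_atTop (C : ℝ) {δ : ℝ} (hδ : 0 < δ) :
    Tendsto (fun x : ℝ => C * Real.exp (-δ * x)) atTop (𝓝 0) := by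
  have : Tendsto (fun x : ℝ => -δ * x) atTop atBot :=
    tendsto_id.const_mul_atTop_of_neg (by linarith)
  simpa using (Real.tendsto_exp_atBot.comp this).const_mul C

theorem integrable_of_norm_le_exp {g : ℝ → ℂ} (hg : Continuous g) {C δ : ℝ} (hδ : 0 < δ)
    (h : ∀ x : ℝ, 1 ≤ |x| → ‖g x‖ ≤ C * Real.exp (-δ * |x|)) : Integrable g := by
  refine hg.locallyIntegrable.integrable_of_isBigO_cocompact
    (g := fun x : ℝ => Real.exp (-δ * |x|)) ?_ ?_
  · refine Asymptotics.IsBigO.of_bound C ?_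
    have : ∀ᶠ x : ℝ in cocompact ℝ, 1 ≤ |x| :=
      (tendsto_norm_cocompact_atTop (E := ℝ)).eventually_ge_atTop 1
    filter_upwards [this] with x hx
    simpa [abs_of_pos (Real.exp_pos _)] using h x hx
  · exact (integrable_exp_neg_mul_abs hδ).integrableAtFilter _

theorem continuous_horizontal_line {f : ℂ → ℂ} {v : ℝ}
    (hf : ∀ z : ℂ, z.im = v → ContinuousAt f z) :
    Continuous fun x : ℝ => f (x + v * Complex.I) := by
  refine continuous_iff_continuousAt.mpr fun x => ?_
  exact ContinuousAt.comp (f := fun x : ℝ => (x + v * Complex.I : ℂ)) (hf _ (by simp))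
    (by fun_prop)

/-- Horizontal contours may be shifted inside a strip where the integrand decays exponentially. -/
theorem integral_horizontal_line_eq {f : ℂ → ℂ} {v₁ v₂ : ℝ} (hv : v₁ ≤ v₂)
    (hf : ∀ z : ℂ, v₁ ≤ z.im → z.im ≤ v₂ → DifferentiableAt ℂ f z) {C δ : ℝ} (hδ : 0 < δ)
    (hfM : ∀ x v : ℝ, 1 ≤ |x| → v₁ ≤ v → v ≤ v₂ →
      ‖f (x + v * Complex.I)‖ ≤ C * Real.exp (-δ * |x|)) :
    ∫ x : ℝ, f (x + v₁ * Complex.I) = ∫ x : ℝ, f (x + v₂ * Complex.I) := by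
  have key := tendsto_sub_integral_strip hv hf (tendsto_exp_neg_mul_atTop C hδ) hfM
  have lim : ∀ v, v₁ ≤ v → v ≤ v₂ → Tendsto (fun T : ℝ => ∫ x : ℝ in -T..T, f (x + v * Complex.I))
      atTop (𝓝 (∫ x : ℝ, f (x + v * Complex.I))) := fun v h1 h2 =>
    intervalIntegral_tendsto_integral
      (integrable_of_norm_le_exp (continuous_horizontal_line fun z hz =>
        (hf z (by rw [hz]; exact h1) (by rw [hz]; exact h2)).continuousAt) hδ
        fun x hx => hfM x v hx h1 h2) tendsto_neg_atTop_atBot tendsto_id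
  exact sub_eq_zero.mp (tendsto_nhds_unique ((lim v₁ le_rfl hv).sub (lim v₂ hv le_rfl)) key)

theorem add_mul_I_ne_zero {v : ℝ} (hv : v ≠ 0) (x : ℝ) : (x + v * Complex.I : ℂ) ≠ 0 := by
  intro h
  have := congrArg Complex.im h
  simp at this
  exact hv this

theorem integral_inv_horizontal {v : ℝ} (hv : v ≠ 0) (T : ℝ) :
    ∫ x : ℝ in -T..T, (x + v * Complex.I : ℂ)⁻¹ = -2 * Complex.I * Real.arctan (T / v) := by
  have hpos : ∀ x : ℝ, 0 < x ^ 2 + v ^ 2 := fun x => by positivity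
  have hd : ∀ x : ℝ, HasDerivAt (fun x : ℝ => ((1 / 2 * Real.log (x ^ 2 + v ^ 2) : ℝ) : ℂ) -
      Complex.I * (Real.arctan (x / v) : ℝ)) ((x + v * Complex.I : ℂ)⁻¹) x := by
    intro x
    have h1 : HasDerivAt (fun x : ℝ => 1 / 2 * Real.log (x ^ 2 + v ^ 2))
        (x / (x ^ 2 + v ^ 2)) x := by
      have := ((((hasDerivAt_id' x).pow 2).add_const (v ^ 2)).log (hpos x).ne').const_mul (1 / 2)
      refine this.congr_deriv ?_
      have := (hpos x).ne'
      simp only [Pi.pow_apply]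
      field_simp
      norm_num
    have h2 : HasDerivAt (fun x : ℝ => Real.arctan (x / v)) (v / (x ^ 2 + v ^ 2)) x := by
      have := ((hasDerivAt_id' x).div_const v).arctan
      refine this.congr_deriv ?_
      have := (hpos x).ne'
      have h3 : (1 + (x / v) ^ 2) ≠ 0 := by positivity
      field_simp
      ring
    have := h1.ofReal_comp.sub (h2.ofReal_comp.const_mul Complex.I)
    refine this.congr_deriv ?_
    have h3 := add_mul_I_ne_zero hv x
    have h4 : ((x : ℂ) ^ 2 + (v : ℂ) ^ 2) ≠ 0 := by exact_mod_cast (hpos x).ne'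
    push_cast
    field_simp
    linear_combination (-(v:ℂ)^2) * Complex.I_sq
  rw [intervalIntegral.integral_eq_sub_of_hasDerivAt (fun x _ => hd x)]
  · simp [neg_div, Real.arctan_neg]
    ring
  · exact (Continuous.inv₀ (by fun_prop) (add_mul_I_ne_zero hv)).intervalIntegrable _ _

theorem integral_inv_cube_horizontal {v : ℝ} (hv : v ≠ 0) (T : ℝ) :
    ∫ x : ℝ in -T..T, 1 / (x + v * Complex.I : ℂ) ^ 3 =
      -1 / 2 / (T + v * Complex.I) ^ 2 + 1 / 2 / (-T + v * Complex.I) ^ 2 := by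
  have hd : ∀ x : ℝ, HasDerivAt (fun x : ℝ => -1 / 2 / (x + v * Complex.I : ℂ) ^ 2)
      (1 / (x + v * Complex.I : ℂ) ^ 3) x := by
    intro x
    have h0 := add_mul_I_ne_zero hv x
    have h1 : HasDerivAt (fun z : ℂ => -1 / 2 / (z + v * Complex.I : ℂ) ^ 2)
      (1 / (x + v * Complex.I : ℂ) ^ 3) (x : ℂ) := by
      have := ((((hasDerivAt_id' (x : ℂ)).add_const (v * Complex.I)).pow 2).inv
        (pow_ne_zero 2 h0)).const_mul (-1 / 2)
      refine this.congr_deriv ?_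
      simp
      field_simp
    exact h1.comp_ofReal
  rw [intervalIntegral.integral_eq_sub_of_hasDerivAt (fun x _ => hd x)]
  · push_cast
    ring
  · exact (Continuous.div continuous_const (by fun_prop)
      (fun x => pow_ne_zero 3 (add_mul_I_ne_zero hv x))).intervalIntegrable _ _

theorem tendsto_inv_sq_horizontal (v : ℝ) (s : ℝ) (hs : |s| = 1) :
    Tendsto (fun T : ℝ => (1 / 2 / ((s * T : ℝ) + v * Complex.I) ^ 2 : ℂ)) atTop (𝓝 0) := by
  rw [tendsto_zero_iff_norm_tendsto_zero]
  have h : Tendsto (fun T : ℝ => 1 / 2 / T ^ 2) atTop (𝓝 0) :=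
    (tendsto_pow_atTop two_ne_zero).const_div_atTop _
  refine squeeze_zero' (Eventually.of_forall fun _ => norm_nonneg _) ?_ h
  filter_upwards [eventually_gt_atTop 0] with T hT
  have : T ≤ ‖((s * T : ℝ) + v * Complex.I : ℂ)‖ := by
    refine le_trans ?_ (Complex.abs_re_le_norm _)
    simp [abs_mul, hs, le_abs_self]
  rw [norm_div, norm_pow]
  gcongr
  simp

/-- The residue theorem on the strip `v₁ ≤ Im z ≤ v₂` for a function whose only singularity is at
the origin, with principal part `A / z ^ 3 + B / z`. -/
theorem integral_horizontal_sub_eq_residue {f : ℂ → ℂ} {v₁ v₂ : ℝ} (hv₁ : v₁ < 0) (hv₂ : 0 < v₂)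
    (A B : ℂ)
    (hf : ∀ z : ℂ, v₁ ≤ z.im → z.im ≤ v₂ → z ≠ 0 → DifferentiableAt ℂ f z) {C δ : ℝ} (hδ : 0 < δ)
    (hfM : ∀ x v : ℝ, 1 ≤ |x| → v₁ ≤ v → v ≤ v₂ →
      ‖f (x + v * Complex.I)‖ ≤ C * Real.exp (-δ * |x|))
    (hres : (fun z => f z - A / z ^ 3 - B / z) =O[𝓝[≠] 0] fun _ => (1 : ℝ)) :
    (∫ x : ℝ, f (x + v₁ * Complex.I)) - ∫ x : ℝ, f (x + v₂ * Complex.I) =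
      2 * π * Complex.I * B := by
  have hv : v₁ ≤ v₂ := by linarith
  set h0 : ℂ → ℂ := fun z => f z - A / z ^ 3 - B / z with hh0
  set h : ℂ → ℂ := Function.update h0 0 (limUnder (𝓝[≠] 0) h0) with hh
  have hne : ∀ z, z ≠ 0 → h z = h0 z := fun z hz => Function.update_of_ne hz _ _
  have hd0 : ∀ z : ℂ, v₁ ≤ z.im → z.im ≤ v₂ → z ≠ 0 → DifferentiableAt ℂ h0 z := by
    intro z h1 h2 hz
    have := hf z h1 h2 hz
    have h3 : z ^ 3 ≠ 0 := pow_ne_zero 3 hz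
    fun_prop (disch := assumption)
  have hopen : IsOpen {z : ℂ | v₁ < z.im ∧ z.im < v₂} :=
    (isOpen_lt continuous_const Complex.continuous_im).inter
      (isOpen_lt Complex.continuous_im continuous_const)
  have hd : ∀ z : ℂ, v₁ ≤ z.im → z.im ≤ v₂ → DifferentiableAt ℂ h z := by
    intro z h1 h2
    rcases eq_or_ne z 0 with rfl | hz
    · have hs : {z : ℂ | v₁ < z.im ∧ z.im < v₂} ∈ 𝓝 (0 : ℂ) :=
        hopen.mem_nhds ⟨by simpa using hv₁, by simpa using hv₂⟩
      refine (Complex.differentiableOn_update_limUnder_of_isLittleO hs ?_ ?_).differentiableAt hs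
      · rintro z ⟨hz, hz0⟩
        exact (hd0 z hz.1.le hz.2.le hz0).differentiableWithinAt
      · refine Filter.IsBoundedUnder.isLittleO_sub_self_inv ?_
        exact (Asymptotics.isBigO_one_iff ℝ).mp
          (hres.sub (Asymptotics.isBigO_const_const _ one_ne_zero _))
    · refine (hd0 z h1 h2 hz).congr_of_eventuallyEq ?_
      filter_upwards [isOpen_ne.mem_nhds hz] with w hw using hne w hw
  have hM : Tendsto (fun x : ℝ => C * Real.exp (-δ * x) + (‖A‖ / x ^ 3 + ‖B‖ / x))
      atTop (𝓝 0) := by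
    have h1 : Tendsto (fun x : ℝ => ‖A‖ / x ^ 3) atTop (𝓝 0) :=
      (tendsto_pow_atTop three_ne_zero).const_div_atTop _
    have h2 : Tendsto (fun x : ℝ => ‖B‖ / x) atTop (𝓝 0) := tendsto_id.const_div_atTop _
    simpa using (tendsto_exp_neg_mul_atTop C hδ).add (h1.add h2)
  have key := tendsto_sub_integral_strip hv hd hM (by
    intro x v hx h1 h2
    have hx0 : x ≠ 0 := by
      rintro rfl
      simp at hx
      linarith
    have hz : (x + v * Complex.I : ℂ) ≠ 0 := by
      intro h
      have := congrArg Complex.re h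
      simp at this
      exact hx0 this
    have hge : |x| ≤ ‖(x + v * Complex.I : ℂ)‖ := by
      refine le_trans ?_ (Complex.abs_re_le_norm _)
      simp
    have hxp : 0 < |x| := by positivity
    rw [hne _ hz, hh0]
    refine (norm_sub_le _ _).trans ?_
    rw [← add_assoc]
    refine add_le_add ((norm_sub_le _ _).trans (add_le_add (hfM x v hx h1 h2) ?_)) ?_
    · rw [norm_div, norm_pow]
      gcongr
    · rw [norm_div]
      gcongr)
  have lim : ∀ v, v₁ ≤ v → v ≤ v₂ → v ≠ 0 →
      Tendsto (fun T : ℝ => ∫ x : ℝ in -T..T, f (x + v * Complex.I))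
      atTop (𝓝 (∫ x : ℝ, f (x + v * Complex.I))) ∧
      Continuous (fun x : ℝ => f (x + v * Complex.I)) := fun v h1 h2 h3 => by
    have hc : Continuous (fun x : ℝ => f (x + v * Complex.I)) :=
      continuous_horizontal_line fun z hz =>
        (hf z (by rw [hz]; exact h1) (by rw [hz]; exact h2)
          (by rintro rfl; exact h3 (by simpa using hz.symm))).continuousAt
    exact ⟨intervalIntegral_tendsto_integral
      (integrable_of_norm_le_exp hc hδ
        fun x hx => hfM x v hx h1 h2) tendsto_neg_atTop_atBot tendsto_id, hc⟩
  have split : ∀ v, v₁ ≤ v → v ≤ v₂ → v ≠ 0 → ∀ T : ℝ,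
      ∫ x : ℝ in -T..T, h (x + v * Complex.I) =
      (∫ x : ℝ in -T..T, f (x + v * Complex.I)) +
        A * (1 / 2 / ((1 * T : ℝ) + v * Complex.I) ^ 2 - 1 / 2 / ((-1 * T : ℝ) + v * Complex.I) ^ 2)
        + B * (2 * Complex.I * Real.arctan (T / v)) := by
    intro v h1 h2 h3 T
    have hc := (lim v h1 h2 h3).2
    have e : ∀ x : ℝ, h (x + v * Complex.I) = f (x + v * Complex.I) -
        A * (1 / (x + v * Complex.I) ^ 3) - B * (x + v * Complex.I)⁻¹ := by
      intro x
      rw [hne _ (add_mul_I_ne_zero h3 x), hh0]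
      simp only [div_eq_mul_inv, one_mul]
    simp_rw [e]
    have c3 : Continuous fun x : ℝ => 1 / (x + v * Complex.I : ℂ) ^ 3 :=
      Continuous.div continuous_const (by fun_prop)
        (fun x => pow_ne_zero 3 (add_mul_I_ne_zero h3 x))
    have c1 : Continuous fun x : ℝ => (x + v * Complex.I : ℂ)⁻¹ :=
      Continuous.inv₀ (by fun_prop) (add_mul_I_ne_zero h3)
    rw [intervalIntegral.integral_sub, intervalIntegral.integral_sub,
      intervalIntegral.integral_const_mul, intervalIntegral.integral_const_mul,
      integral_inv_horizontal h3, integral_inv_cube_horizontal h3]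
    · push_cast
      ring
    · exact hc.intervalIntegrable _ _
    · exact (continuous_const.mul c3).intervalIntegrable _ _
    · exact (hc.sub (continuous_const.mul c3)).intervalIntegrable _ _
    · exact (continuous_const.mul c1).intervalIntegrable _ _
  have at2 : Tendsto (fun T : ℝ => (Real.arctan (T / v₂) : ℂ)) atTop (𝓝 ((π / 2 : ℝ) : ℂ)) :=
    (Complex.continuous_ofReal.tendsto _).comp ((tendsto_arctan_atTop.mono_right
      nhdsWithin_le_nhds).comp (tendsto_id.atTop_div_const hv₂))
  have at1 : Tendsto (fun T : ℝ => (Real.arctan (T / v₁) : ℂ)) atTop (𝓝 ((-(π / 2) : ℝ) : ℂ)) :=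
    (Complex.continuous_ofReal.tendsto _).comp ((tendsto_arctan_atBot.mono_right
      nhdsWithin_le_nhds).comp (tendsto_id.atTop_div_const_of_neg hv₁))
  have sq : ∀ v : ℝ, Tendsto (fun T : ℝ => A * ((1 / 2 / ((1 * T : ℝ) + v * Complex.I) ^ 2 : ℂ) -
      1 / 2 / ((-1 * T : ℝ) + v * Complex.I) ^ 2)) atTop (𝓝 0) := fun v => by
    simpa only [sub_zero, mul_zero] using ((tendsto_inv_sq_horizontal v 1 (by simp)).sub
      (tendsto_inv_sq_horizontal v (-1) (by simp))).const_mul A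
  have L1 := (((lim v₁ le_rfl hv hv₁.ne).1.add (sq v₁)).add
    ((at1.const_mul (2 * Complex.I)).const_mul B))
  have L2 := (((lim v₂ hv le_rfl hv₂.ne').1.add (sq v₂)).add
    ((at2.const_mul (2 * Complex.I)).const_mul B))
  simp_rw [split v₁ le_rfl hv hv₁.ne, split v₂ hv le_rfl hv₂.ne'] at key
  have := tendsto_nhds_unique (L1.sub L2) key
  push_cast at this
  linear_combination this

/-- Differentiation under the integral sign for a Fourier–Laplace transform. -/
theorem hasDerivAt_fourierLaplace {g : ℝ → ℂ} (hg : Continuous g) (z₀ : ℂ) {C δ : ℝ} (hδ : 0 < δ)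
    (h : ∀ t : ℝ, ‖g t‖ * Real.exp (z₀.im * t) ≤ C * Real.exp (-δ * |t|)) :
    Integrable (fun t : ℝ => g t * Complex.exp (-Complex.I * z₀ * t)) ∧
    HasDerivAt (fun z : ℂ => ∫ t : ℝ, g t * Complex.exp (-Complex.I * z * t))
      (∫ t : ℝ, g t * (-Complex.I * t * Complex.exp (-Complex.I * z₀ * t))) z₀ := by
  have hn : ∀ (z : ℂ) (t : ℝ), ‖Complex.exp (-Complex.I * z * t)‖ = Real.exp (z.im * t) := by
    intro z t
    rw [Complex.norm_exp]
    simp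
  have hcont : ∀ z : ℂ, Continuous fun t : ℝ => g t * Complex.exp (-Complex.I * z * t) := by
    intro z
    fun_prop
  have hint : Integrable (fun t : ℝ => g t * Complex.exp (-Complex.I * z₀ * t)) := by
    refine integrable_of_norm_le_exp (C := C) (hcont z₀) hδ fun t _ => ?_
    rw [norm_mul, hn]
    exact h t
  refine ⟨hint, ?_⟩
  have hC : 0 ≤ C := by
    have := h 0
    simp at this
    exact (norm_nonneg _).trans this
  refine (hasDerivAt_integral_of_dominated_loc_of_deriv_le
    (bound := fun t => C * (4 / δ) * Real.exp (-(δ / 4) * |t|))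
    (F := fun z (t : ℝ) => g t * Complex.exp (-Complex.I * z * t))
    (F' := fun z (t : ℝ) => g t * (-Complex.I * t * Complex.exp (-Complex.I * z * t)))
    (Metric.ball_mem_nhds z₀ (half_pos hδ))
    (Eventually.of_forall fun z => (hcont z).aestronglyMeasurable) hint
    (by exact Continuous.aestronglyMeasurable (by fun_prop)) ?_
    ((integrable_exp_neg_mul_abs (by positivity)).const_mul _) ?_).2
  · refine Eventually.of_forall fun t z hz => ?_
    have him : |z.im - z₀.im| ≤ δ / 2 := by
      rw [← Complex.sub_im]
      exact (Complex.abs_im_le_norm _).trans (by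
        rw [Metric.mem_ball, dist_eq_norm] at hz
        exact hz.le)
    have h1 : Real.exp (z.im * t) ≤ Real.exp (z₀.im * t) * Real.exp (δ / 2 * |t|) := by
      rw [← Real.exp_add, Real.exp_le_exp]
      have : (z.im - z₀.im) * t ≤ δ / 2 * |t| := by
        refine (le_abs_self _).trans ?_
        rw [abs_mul]
        gcongr
      linarith
    have h2 : |t| ≤ 4 / δ * Real.exp (δ / 4 * |t|) := by
      have := Real.add_one_le_exp (δ / 4 * |t|)
      calc |t| = 4 / δ * (δ / 4 * |t|) := by field_simp
        _ ≤ _ := by gcongr; linarith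
    rw [norm_mul, norm_mul, norm_mul, hn]
    simp only [norm_neg, Complex.norm_I, one_mul, Complex.norm_real, Real.norm_eq_abs]
    calc ‖g t‖ * (|t| * Real.exp (z.im * t))
        ≤ ‖g t‖ * ((4 / δ * Real.exp (δ / 4 * |t|)) *
          (Real.exp (z₀.im * t) * Real.exp (δ / 2 * |t|))) := by gcongr
      _ = (‖g t‖ * Real.exp (z₀.im * t)) *
          (4 / δ * Real.exp (δ / 4 * |t|) * Real.exp (δ / 2 * |t|)) := by ring
      _ ≤ (C * Real.exp (-δ * |t|)) *
          (4 / δ * Real.exp (δ / 4 * |t|) * Real.exp (δ / 2 * |t|)) := by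
          exact mul_le_mul_of_nonneg_right (h t) (by positivity)
      _ = C * (4 / δ) * (Real.exp (-δ * |t|) * Real.exp (δ / 4 * |t|) * Real.exp (δ / 2 * |t|)) := by
          ring
      _ = _ := by
          rw [← Real.exp_add, ← Real.exp_add]
          congr 2
          ring
  · refine Eventually.of_forall fun t z _ => ?_
    have h1 : HasDerivAt (fun z : ℂ => -Complex.I * z * t) (-Complex.I * t) z := by
      simpa using ((hasDerivAt_id' z).const_mul (-Complex.I)).mul_const (t : ℂ)
    refine (h1.cexp.const_mul (g t)).congr_deriv ?_
    ring

theorem hasDerivAt_fourierLaplace_line {g : ℝ → ℂ} (hg : Continuous g) (α β : ℝ) (z₀ : ℂ)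
    {C δ : ℝ} (hδ : 0 < δ)
    (h : ∀ t : ℝ, ‖g t‖ * Real.exp (α * z₀.im * t) ≤ C * Real.exp (-δ * |t|)) :
    Integrable (fun t : ℝ => g t * Complex.exp (-Complex.I * α * z₀ * (t + β * Complex.I))) ∧
    HasDerivAt (fun z : ℂ => ∫ t : ℝ, g t * Complex.exp (-Complex.I * α * z * (t + β * Complex.I)))
      (∫ t : ℝ, g t * (-Complex.I * α * (t + β * Complex.I) *
        Complex.exp (-Complex.I * α * z₀ * (t + β * Complex.I)))) z₀ := by
  have e : ∀ (z : ℂ) (t : ℝ), Complex.exp (-Complex.I * α * z * (t + β * Complex.I)) =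
      Complex.exp (α * β * z) * Complex.exp (-Complex.I * (α * z) * t) := by
    intro z t
    rw [← Complex.exp_add]
    congr 1
    linear_combination (-α * β * z : ℂ) * Complex.I_sq
  have e2 : ∀ (z : ℂ) (t : ℝ), g t * Complex.exp (-Complex.I * α * z * (t + β * Complex.I)) =
      Complex.exp (α * β * z) * (g t * Complex.exp (-Complex.I * (α * z) * t)) := by
    intro z t
    rw [e]
    ring
  obtain ⟨hi, hd⟩ := hasDerivAt_fourierLaplace hg (α * z₀) hδ (by simpa using h)
  refine ⟨by simp_rw [e2]; exact hi.const_mul _, ?_⟩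
  have hi2 : Integrable fun t : ℝ =>
      g t * (-Complex.I * t * Complex.exp (-Complex.I * (α * z₀) * t)) := by
    have hC : 0 ≤ C := by
      have := h 0
      simp at this
      exact (norm_nonneg _).trans this
    refine integrable_of_norm_le_exp (C := C * (2 / δ)) (δ := δ / 2) (by fun_prop) (by linarith)
      fun t _ => ?_
    have h2 : |t| ≤ 2 / δ * Real.exp (δ / 2 * |t|) := by
      have := Real.add_one_le_exp (δ / 2 * |t|)
      calc |t| = 2 / δ * (δ / 2 * |t|) := by field_simp
        _ ≤ _ := by gcongr; linarith
    have hn : ‖Complex.exp (-Complex.I * (α * z₀) * t)‖ = Real.exp (α * z₀.im * t) := by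
      rw [Complex.norm_exp]
      simp
    rw [norm_mul, norm_mul, norm_mul, hn]
    simp only [norm_neg, Complex.norm_I, one_mul, Complex.norm_real, Real.norm_eq_abs]
    calc ‖g t‖ * (|t| * Real.exp (α * z₀.im * t))
        = (‖g t‖ * Real.exp (α * z₀.im * t)) * |t| := by ring
      _ ≤ (C * Real.exp (-δ * |t|)) * (2 / δ * Real.exp (δ / 2 * |t|)) :=
          mul_le_mul (h t) h2 (abs_nonneg _) (by positivity)
      _ = C * (2 / δ) * (Real.exp (-δ * |t|) * Real.exp (δ / 2 * |t|)) := by ring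
      _ = _ := by
          rw [← Real.exp_add]
          congr 2
          ring
  have h1 : HasDerivAt (fun z : ℂ => (α : ℂ) * z) α z₀ := by
    simpa using (hasDerivAt_id' z₀).const_mul (α : ℂ)
  have h2 : HasDerivAt (fun z : ℂ => Complex.exp (α * β * z))
      (Complex.exp (α * β * z₀) * (α * β)) z₀ := by
    simpa using ((hasDerivAt_id' z₀).const_mul (α * β : ℂ)).cexp
  have h3 := h2.mul (HasDerivAt.comp z₀ hd h1)
  have e3 : (fun z : ℂ => ∫ t : ℝ, g t * Complex.exp (-Complex.I * α * z * (t + β * Complex.I))) =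
      (fun z : ℂ => Complex.exp (α * β * z)) *
      ((fun z : ℂ => ∫ t : ℝ, g t * Complex.exp (-Complex.I * z * t)) ∘ fun z : ℂ => (α : ℂ) * z) := by
    funext z
    simp_rw [e2, integral_const_mul]
    rfl
  rw [e3]
  refine h3.congr_deriv ?_
  have e4 : ∀ t : ℝ, g t * (-Complex.I * α * (t + β * Complex.I) *
        Complex.exp (-Complex.I * α * z₀ * (t + β * Complex.I))) =
      Complex.exp (α * β * z₀) * (α * β) * (g t * Complex.exp (-Complex.I * (α * z₀) * t)) +
      Complex.exp (α * β * z₀) * α *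
        (g t * (-Complex.I * t * Complex.exp (-Complex.I * (α * z₀) * t))) := by
    intro t
    rw [e]
    linear_combination (-g t * α * β * Complex.exp (α * β * z₀) *
      Complex.exp (-Complex.I * (α * z₀) * t)) * Complex.I_sq
  simp_rw [e4]
  rw [integral_add (hi.const_mul _) (hi2.const_mul _), integral_const_mul, integral_const_mul]
  simp only [Function.comp]
  ring

theorem normSq_sinh_add_mul_I (u v : ℝ) :
    ‖Complex.sinh (u + v * Complex.I)‖ ^ 2 = Real.sinh u ^ 2 + Real.sin v ^ 2 := by
  rw [Complex.sinh_add, Complex.sinh_mul_I, Complex.cosh_mul_I, ← Complex.normSq_eq_norm_sq, ← Complex.ofReal_sinh,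
    ← Complex.ofReal_cosh, ← Complex.ofReal_sin, ← Complex.ofReal_cos, Complex.normSq_apply]
  simp [-Complex.ofReal_sinh, -Complex.ofReal_cosh, -Complex.ofReal_sin, -Complex.ofReal_cos]
  have h1 := Real.cosh_sq u
  have h2 := Real.sin_sq_add_cos_sq v
  linear_combination (Real.sin v ^ 2) * h1 + Real.sinh u ^ 2 * h2

theorem abs_sin_mul_exp_le_norm_sinh (u v : ℝ) :
    |Real.sin v| * Real.exp |u| / 2 ≤ ‖Complex.sinh (u + v * Complex.I)‖ := by
  have h1 : |Real.sin v| * Real.cosh u ≤ ‖Complex.sinh (u + v * Complex.I)‖ := by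
    refine (abs_le_of_sq_le_sq' ?_ (norm_nonneg _)).2
    rw [normSq_sinh_add_mul_I, mul_pow, sq_abs, Real.cosh_sq]
    have := Real.sin_sq_le_one v
    nlinarith [sq_nonneg (Real.sinh u)]
  refine le_trans ?_ h1
  rw [mul_div_assoc]
  gcongr
  rw [← Real.cosh_abs, Real.cosh_eq]
  have := Real.exp_pos (-|u|)
  linarith

theorem mul_exp_le_norm_sinh {u₀ u : ℝ} (v : ℝ) (hu : u₀ ≤ |u|) :
    (1 - Real.exp (-2 * u₀)) / 2 * Real.exp |u| ≤ ‖Complex.sinh (u + v * Complex.I)‖ := by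
  have h1 : Real.sinh |u| ≤ ‖Complex.sinh (u + v * Complex.I)‖ := by
    refine (abs_le_of_sq_le_sq' ?_ (norm_nonneg _)).2
    rw [normSq_sinh_add_mul_I]
    have : Real.sinh |u| ^ 2 = Real.sinh u ^ 2 := by
      rcases abs_choice u with h | h <;> simp [h]
    rw [this]
    nlinarith [sq_nonneg (Real.sin v)]
  refine le_trans ?_ h1
  rw [Real.sinh_eq]
  have : Real.exp (-|u|) ≤ Real.exp (-2 * u₀) * Real.exp |u| := by
    rw [← Real.exp_add, Real.exp_le_exp]
    linarith
  linarith

theorem sinh_ne_zero_of_abs_im_lt {w : ℂ} (hw : w ≠ 0) (him : |w.im| < π) :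
    Complex.sinh w ≠ 0 := by
  intro h
  have h1 := normSq_sinh_add_mul_I w.re w.im
  rw [Complex.re_add_im, h] at h1
  simp at h1
  have h2 : Real.sinh w.re = 0 := by nlinarith [sq_nonneg (Real.sinh w.re), sq_nonneg (Real.sin w.im)]
  have h3 : Real.sin w.im = 0 := by nlinarith [sq_nonneg (Real.sinh w.re), sq_nonneg (Real.sin w.im)]
  rw [abs_lt] at him
  apply hw
  apply Complex.ext
  · simpa using h2
  · simpa using (Real.sin_eq_zero_iff_of_lt_of_lt him.1 him.2).mp h3

/-- The height `π min(𝖻, 𝖻⁻¹) / 2` of the contour defining `Φ_𝖻`. -/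
def contourHeight (bb : ℝ) : ℝ := π * min bb bb⁻¹ / 2

/-- The logarithm of Faddeev's quantum dilogarithm on the strip. -/
def logPhi (bb : ℝ) (z : ℂ) : ℂ :=
  ∫ t : ℝ, phiKer bb z (t + contourHeight bb * Complex.I)

theorem PhiS_eq_exp_logPhi (bb : ℝ) (z : ℂ) : PhiS bb z = Complex.exp (logPhi bb z) := by
  have : (Complex.I * (π * (min bb bb⁻¹ : ℝ) / 2) : ℂ) = contourHeight bb * Complex.I := by
    unfold contourHeight
    push_cast
    ring
  rw [PhiS, logPhi, this]

theorem contourHeight_pos {bb : ℝ} (hbb : 0 < bb) : 0 < contourHeight bb := by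
  unfold contourHeight
  have : 0 < min bb bb⁻¹ := lt_min hbb (inv_pos.mpr hbb)
  positivity

theorem contourHeight_mul_le {bb : ℝ} (hbb : 0 < bb) : contourHeight bb * bb ≤ π / 2 := by
  have h : min bb bb⁻¹ * bb ≤ 1 := by
    calc min bb bb⁻¹ * bb ≤ bb⁻¹ * bb := by gcongr; exact min_le_right _ _
      _ = 1 := inv_mul_cancel₀ hbb.ne'
  unfold contourHeight
  nlinarith [Real.pi_pos]

theorem contourHeight_div_le {bb : ℝ} (hbb : 0 < bb) : contourHeight bb / bb ≤ π / 2 := by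
  have h : min bb bb⁻¹ ≤ bb := min_le_left _ _
  unfold contourHeight
  rw [div_le_iff₀ hbb]
  nlinarith [Real.pi_pos]

theorem sin_contourHeight_mul_pos {bb : ℝ} (hbb : 0 < bb) : 0 < Real.sin (contourHeight bb * bb) :=
  Real.sin_pos_of_pos_of_lt_pi (mul_pos (contourHeight_pos hbb) hbb)
    (by linarith [contourHeight_mul_le hbb, Real.pi_pos])

theorem sin_contourHeight_div_pos {bb : ℝ} (hbb : 0 < bb) : 0 < Real.sin (contourHeight bb / bb) :=
  Real.sin_pos_of_pos_of_lt_pi (div_pos (contourHeight_pos hbb) hbb)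
    (by linarith [contourHeight_div_le hbb, Real.pi_pos])

/-- An explicit constant bounding `1 / (4 sinh(w𝖻) sinh(w/𝖻) w)` on the contour, up to
exponential decay. -/
def kerBound (bb : ℝ) : ℝ :=
  1 / (contourHeight bb * Real.sin (contourHeight bb * bb) * Real.sin (contourHeight bb / bb))

theorem kerBound_pos {bb : ℝ} (hbb : 0 < bb) : 0 < kerBound bb := by
  have h1 := contourHeight_pos hbb
  have h2 := sin_contourHeight_mul_pos hbb
  have h3 := sin_contourHeight_div_pos hbb
  unfold kerBound
  positivity

theorem norm_sinh_mul_contour_ge {bb : ℝ} (hbb : 0 < bb) (t : ℝ) :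
    Real.sin (contourHeight bb * bb) * Real.exp (bb * |t|) / 2 ≤
      ‖Complex.sinh ((t + contourHeight bb * Complex.I) * bb)‖ := by
  have h := abs_sin_mul_exp_le_norm_sinh (t * bb) (contourHeight bb * bb)
  rw [abs_of_pos (sin_contourHeight_mul_pos hbb), abs_mul, abs_of_pos hbb, mul_comm |t|] at h
  convert h using 3
  push_cast
  ring

theorem norm_sinh_div_contour_ge {bb : ℝ} (hbb : 0 < bb) (t : ℝ) :
    Real.sin (contourHeight bb / bb) * Real.exp (bb⁻¹ * |t|) / 2 ≤
      ‖Complex.sinh ((t + contourHeight bb * Complex.I) / bb)‖ := by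
  have h := abs_sin_mul_exp_le_norm_sinh (t / bb) (contourHeight bb / bb)
  rw [abs_of_pos (sin_contourHeight_div_pos hbb), abs_div, abs_of_pos hbb,
    div_eq_inv_mul |t|] at h
  convert h using 3
  push_cast
  ring

theorem contourHeight_le_norm (bb : ℝ) (t : ℝ) :
    contourHeight bb ≤ ‖(t + contourHeight bb * Complex.I : ℂ)‖ := by
  refine le_trans ?_ (Complex.abs_im_le_norm _)
  simp [le_abs_self]

theorem norm_inv_den_le {bb : ℝ} (hbb : 0 < bb) (t : ℝ) :
    ‖(4 * Complex.sinh ((t + contourHeight bb * Complex.I) * bb) *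
      Complex.sinh ((t + contourHeight bb * Complex.I) / bb) *
      (t + contourHeight bb * Complex.I))⁻¹‖ ≤
      kerBound bb * Real.exp (-(bb + bb⁻¹) * |t|) := by
  have h1 := contourHeight_pos hbb
  have h2 := sin_contourHeight_mul_pos hbb
  have h3 := sin_contourHeight_div_pos hbb
  rw [norm_inv, norm_mul, norm_mul, norm_mul]
  have key : (contourHeight bb * Real.sin (contourHeight bb * bb) *
      Real.sin (contourHeight bb / bb)) * Real.exp ((bb + bb⁻¹) * |t|) ≤
      ‖(4 : ℂ)‖ * ‖Complex.sinh ((t + contourHeight bb * Complex.I) * bb)‖ *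
      ‖Complex.sinh ((t + contourHeight bb * Complex.I) / bb)‖ *
      ‖(t + contourHeight bb * Complex.I : ℂ)‖ := by
    calc _ = 4 * (Real.sin (contourHeight bb * bb) * Real.exp (bb * |t|) / 2) *
          (Real.sin (contourHeight bb / bb) * Real.exp (bb⁻¹ * |t|) / 2) * contourHeight bb := by
          rw [add_mul, Real.exp_add]
          ring
      _ ≤ _ := by
          rw [show ‖(4 : ℂ)‖ = 4 by norm_num]
          gcongr
          · exact norm_sinh_mul_contour_ge hbb t
          · exact norm_sinh_div_contour_ge hbb t
          · exact contourHeight_le_norm bb t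
  refine (inv_anti₀ (by positivity) key).trans (le_of_eq ?_)
  rw [kerBound, neg_mul, Real.exp_neg, mul_inv]
  simp

theorem contour_den_ne_zero {bb : ℝ} (hbb : 0 < bb) (t : ℝ) :
    (4 * Complex.sinh ((t + contourHeight bb * Complex.I) * bb) *
      Complex.sinh ((t + contourHeight bb * Complex.I) / bb) *
      (t + contourHeight bb * Complex.I)) ≠ 0 := by
  have h2 := sin_contourHeight_mul_pos hbb
  have h3 := sin_contourHeight_div_pos hbb
  refine mul_ne_zero (mul_ne_zero (mul_ne_zero (by norm_num) ?_) ?_)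
    (add_mul_I_ne_zero (contourHeight_pos hbb).ne' t)
  · rw [← norm_pos_iff]
    exact lt_of_lt_of_le (by positivity) (norm_sinh_mul_contour_ge hbb t)
  · rw [← norm_pos_iff]
    exact lt_of_lt_of_le (by positivity) (norm_sinh_div_contour_ge hbb t)

theorem continuous_inv_den {bb : ℝ} (hbb : 0 < bb) : Continuous fun t : ℝ =>
    (4 * Complex.sinh ((t + contourHeight bb * Complex.I) * bb) *
      Complex.sinh ((t + contourHeight bb * Complex.I) / bb) *
      (t + contourHeight bb * Complex.I))⁻¹ := by
  refine Continuous.inv₀ ?_ (contour_den_ne_zero hbb)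
  simp only [div_eq_mul_inv]
  fun_prop

theorem phiKer_contour (bb : ℝ) (z : ℂ) (t : ℝ) : phiKer bb z (t + contourHeight bb * Complex.I) =
    (4 * Complex.sinh ((t + contourHeight bb * Complex.I) * bb) *
      Complex.sinh ((t + contourHeight bb * Complex.I) / bb) *
      (t + contourHeight bb * Complex.I))⁻¹ *
    Complex.exp (-Complex.I * (2 : ℝ) * z * (t + contourHeight bb * Complex.I)) := by
  rw [phiKer, div_eq_inv_mul]
  congr 2
  push_cast
  ring

theorem norm_phiKer_contour_le {bb : ℝ} (hbb : 0 < bb) (z : ℂ) (t : ℝ) :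
    ‖phiKer bb z (t + contourHeight bb * Complex.I)‖ ≤
      kerBound bb * Real.exp (2 * contourHeight bb * z.re) *
        Real.exp (-(bb + bb⁻¹ - 2 * |z.im|) * |t|) := by
  rw [phiKer_contour bb, norm_mul]
  have h1 : ‖Complex.exp (-Complex.I * (2 : ℝ) * z * (t + contourHeight bb * Complex.I))‖ ≤
      Real.exp (2 * contourHeight bb * z.re + 2 * |z.im| * |t|) := by
    rw [Complex.norm_exp, Real.exp_le_exp]
    simp
    have : z.im * t ≤ |z.im| * |t| := by
      rw [← abs_mul]
      exact le_abs_self _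
    linarith
  have hk := kerBound_pos hbb
  refine (mul_le_mul (norm_inv_den_le hbb t) h1 (norm_nonneg _) (by positivity)).trans
    (le_of_eq ?_)
  rw [mul_assoc (kerBound bb), mul_assoc (kerBound bb), ← Real.exp_add, ← Real.exp_add]
  congr 2
  ring

theorem integrable_and_differentiableAt_logPhi {bb : ℝ} (hbb : 0 < bb) {z : ℂ}
    (hz : |z.im| < (bb + bb⁻¹) / 2) :
    Integrable (fun t : ℝ => phiKer bb z (t + contourHeight bb * Complex.I)) ∧
      DifferentiableAt ℂ (logPhi bb) z := by
  have h := hasDerivAt_fourierLaplace_line (continuous_inv_den hbb) 2 (contourHeight bb) z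
    (C := kerBound bb) (δ := bb + bb⁻¹ - 2 * |z.im|) (by linarith) (fun t => by
      have h2 : Real.exp (2 * z.im * t) ≤ Real.exp (2 * |z.im| * |t|) := by
        rw [Real.exp_le_exp]
        have : z.im * t ≤ |z.im| * |t| := by
          rw [← abs_mul]
          exact le_abs_self _
        linarith
      have hk := kerBound_pos hbb
      refine (mul_le_mul (norm_inv_den_le hbb t) h2 (Real.exp_nonneg _) (by positivity)).trans
        (le_of_eq ?_)
      rw [mul_assoc, ← Real.exp_add]
      congr 2
      ring)
  refine ⟨by simpa only [phiKer_contour bb] using h.1, ?_⟩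
  have e : logPhi bb = fun z => ∫ t : ℝ, (4 * Complex.sinh ((t + contourHeight bb * Complex.I) * bb) *
      Complex.sinh ((t + contourHeight bb * Complex.I) / bb) *
      (t + contourHeight bb * Complex.I))⁻¹ *
    Complex.exp (-Complex.I * (2 : ℝ) * z * (t + contourHeight bb * Complex.I)) := by
    funext z
    rw [logPhi]
    simp only [phiKer_contour bb]
  rw [e]
  exact h.2.differentiableAt

theorem integrable_phiKer {bb : ℝ} (hbb : 0 < bb) {z : ℂ} (hz : |z.im| < (bb + bb⁻¹) / 2) :
    Integrable (fun t : ℝ => phiKer bb z (t + contourHeight bb * Complex.I)) :=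
  (integrable_and_differentiableAt_logPhi hbb hz).1

theorem differentiableAt_logPhi {bb : ℝ} (hbb : 0 < bb) {z : ℂ} (hz : |z.im| < (bb + bb⁻¹) / 2) :
    DifferentiableAt ℂ (logPhi bb) z :=
  (integrable_and_differentiableAt_logPhi hbb hz).2

theorem norm_logPhi_le {bb : ℝ} (hbb : 0 < bb) {z : ℂ} (hz : |z.im| < (bb + bb⁻¹) / 2) :
    ‖logPhi bb z‖ ≤ kerBound bb * (2 / (bb + bb⁻¹ - 2 * |z.im|)) *
      Real.exp (2 * contourHeight bb * z.re) := by
  have hδ : 0 < bb + bb⁻¹ - 2 * |z.im| := by linarith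
  have h := norm_integral_le_of_norm_le
    ((integrable_exp_neg_mul_abs hδ).const_mul
      (kerBound bb * Real.exp (2 * contourHeight bb * z.re)))
    (Eventually.of_forall (norm_phiKer_contour_le hbb z))
  rw [integral_const_mul, integral_exp_neg_mul_abs hδ] at h
  refine h.trans (le_of_eq ?_)
  ring

theorem exp_mul_sub_sum_isBigO (α : ℂ) (n : ℕ) :
    (fun w : ℂ => Complex.exp (α * w) - ∑ i ∈ Finset.range n, (α * w) ^ i / (i.factorial : ℂ))
      =O[𝓝 0] fun w => w ^ n := by
  have ht : Tendsto (fun w : ℂ => α * w) (𝓝 0) (𝓝 0) := by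
    have : Continuous fun w : ℂ => α * w := by fun_prop
    simpa using this.tendsto 0
  refine ((Complex.exp_sub_sum_range_isBigO_pow n).comp_tendsto ht).trans ?_
  simp only [Function.comp_def, mul_pow]
  exact Asymptotics.isBigO_const_mul_self _ _ _

theorem cosh_mul_sub_isBigO (α : ℂ) :
    (fun w : ℂ => Complex.cosh (α * w) - (1 + (α * w) ^ 2 / 2 + (α * w) ^ 4 / 24))
      =O[𝓝 0] fun w => w ^ 6 := by
  have h := ((exp_mul_sub_sum_isBigO α 6).add (exp_mul_sub_sum_isBigO (-α) 6)).const_mul_left (1 / 2)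
  refine h.congr_left fun w => ?_
  rw [Complex.cosh]
  simp only [Finset.sum_range_succ, Finset.sum_range_zero, Nat.factorial]
  push_cast
  rw [neg_mul]
  ring

theorem sinh_mul_sub_isBigO (α : ℂ) :
    (fun w : ℂ => Complex.sinh (α * w) - α * w) =O[𝓝 0] fun w => w ^ 2 := by
  have h := ((exp_mul_sub_sum_isBigO α 2).sub (exp_mul_sub_sum_isBigO (-α) 2)).const_mul_left (1 / 2)
  refine h.congr_left fun w => ?_
  rw [Complex.sinh]
  simp only [Finset.sum_range_succ, Finset.sum_range_zero, Nat.factorial]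
  push_cast
  rw [neg_mul]
  ring

theorem sinh_mul_inv_isBigO {α : ℂ} (hα : α ≠ 0) :
    (fun w : ℂ => (Complex.sinh (α * w))⁻¹) =O[𝓝 0] fun w => w⁻¹ := by
  have h : Asymptotics.IsEquivalent (𝓝 0) (fun w : ℂ => Complex.sinh (α * w)) fun w => α * w := by
    refine (sinh_mul_sub_isBigO α).trans_isLittleO ?_
    refine Asymptotics.IsLittleO.const_mul_right hα ?_
    have := Asymptotics.isLittleO_pow_pow (𝕜 := ℂ) (m := 1) (n := 2) (by norm_num)
    simp only [pow_one] at this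
    exact this
  refine h.inv.isBigO.trans ?_
  have e : (fun w : ℂ => α * w)⁻¹ = fun w => α⁻¹ * w⁻¹ := by
    funext w
    simp [mul_comm]
  rw [e]
  exact Asymptotics.isBigO_const_mul_self _ _ _

theorem phiKer_add_sub_isBigO {bb : ℝ} (hbb : 0 < bb) (z : ℂ) :
    (fun w => (phiKer bb z w + phiKer bb (-z) w) - (1 / 2 : ℂ) / w ^ 3 -
      (-z ^ 2 - ((bb ^ 2 + (bb⁻¹) ^ 2 : ℝ) : ℂ) / 12) / w) =O[𝓝[≠] 0] fun _ => (1 : ℝ) := by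
  have hb : (bb : ℂ) ≠ 0 := by exact_mod_cast hbb.ne'
  set Q : ℂ := bb + (bb : ℂ)⁻¹ with hQ
  set D : ℂ := bb - (bb : ℂ)⁻¹ with hD
  set B : ℂ := (-z ^ 2 - ((bb ^ 2 + (bb⁻¹) ^ 2 : ℝ) : ℂ) / 12) with hB
  have r1 := cosh_mul_sub_isBigO (2 * Complex.I * z)
  have r2 := cosh_mul_sub_isBigO Q
  have r3 := cosh_mul_sub_isBigO D
  have bdd : ∀ g : ℂ → ℂ, Continuous g → g =O[𝓝 0] fun _ => (1 : ℂ) := fun g hg =>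
    (hg.tendsto 0).isBigO_one ℂ
  have N : (fun w : ℂ => 2 * w ^ 2 * (Complex.cosh (2 * Complex.I * z * w) -
      (1 + (2 * Complex.I * z * w) ^ 2 / 2 + (2 * Complex.I * z * w) ^ 4 / 24)) -
      (1 + 2 * B * w ^ 2) * ((Complex.cosh (Q * w) - (1 + (Q * w) ^ 2 / 2 + (Q * w) ^ 4 / 24)) -
      (Complex.cosh (D * w) - (1 + (D * w) ^ 2 / 2 + (D * w) ^ 4 / 24))) +
      (4 / 3 * z ^ 4 - 2 / 3 * B * ((bb ^ 2 + (bb⁻¹) ^ 2 : ℝ) : ℂ)) * w ^ 6) =O[𝓝 0]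
      fun w => w ^ 6 := by
    refine ((?_ : _ =O[_] _).sub ?_).add (Asymptotics.isBigO_const_mul_self _ _ _)
    · simpa using (bdd (fun w => 2 * w ^ 2) (by fun_prop)).mul r1
    · simpa using (bdd (fun w => 1 + 2 * B * w ^ 2) (by fun_prop)).mul (r2.sub r3)
  have i1 := sinh_mul_inv_isBigO hb
  have i2 := sinh_mul_inv_isBigO (inv_ne_zero hb)
  have key := ((N.mul i1).mul i2).mono (nhdsWithin_le_nhds (s := {0}ᶜ))
  have key2 := key.mul (Asymptotics.isBigO_refl (fun w : ℂ => (4 * w ^ 3)⁻¹) (𝓝[≠] 0))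
  refine (key2.congr' ?_ (EventuallyEq.refl _ _)).trans ?_
  · filter_upwards [self_mem_nhdsWithin,
      nhdsWithin_le_nhds (s := {0}ᶜ) (Metric.ball_mem_nhds (0 : ℂ) (contourHeight_pos hbb))]
      with w hw hwb
    have hw : w ≠ 0 := hw
    have him : |w.im| < contourHeight bb :=
      lt_of_le_of_lt (Complex.abs_im_le_norm _) (by simpa using hwb)
    have s1 : Complex.sinh (bb * w) ≠ 0 := by
      refine sinh_ne_zero_of_abs_im_lt (mul_ne_zero hb hw) ?_
      have := contourHeight_mul_le hbb
      simp only [Complex.im_ofReal_mul, abs_mul, abs_of_pos hbb]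
      nlinarith [Real.pi_pos]
    have s2 : Complex.sinh ((bb : ℂ)⁻¹ * w) ≠ 0 := by
      refine sinh_ne_zero_of_abs_im_lt (mul_ne_zero (inv_ne_zero hb) hw) ?_
      have := contourHeight_div_le hbb
      rw [← Complex.ofReal_inv]
      simp only [Complex.im_ofReal_mul, abs_mul, abs_of_pos (inv_pos.mpr hbb)]
      rw [← div_eq_inv_mul]
      have : |w.im| / bb < contourHeight bb / bb := by gcongr
      linarith [Real.pi_pos]
    have hS : Complex.cosh (Q * w) - Complex.cosh (D * w) =
        2 * Complex.sinh (bb * w) * Complex.sinh ((bb : ℂ)⁻¹ * w) := by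
      rw [hQ, hD, add_mul, sub_mul, Complex.cosh_add, Complex.cosh_sub]
      ring
    have hf : phiKer bb z w + phiKer bb (-z) w = Complex.cosh (2 * Complex.I * z * w) /
        (2 * Complex.sinh (bb * w) * Complex.sinh ((bb : ℂ)⁻¹ * w) * w) := by
      rw [phiKer, phiKer, Complex.cosh, mul_comm w (bb : ℂ), div_eq_inv_mul w (bb : ℂ)]
      rw [show -2 * Complex.I * z * w = -(2 * Complex.I * z * w) by ring,
        show -2 * Complex.I * -z * w = (2 * Complex.I * z * w) by ring]
      field_simp
      ring
    rw [hf]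
    have hQD : Q ^ 2 - D ^ 2 = 4 := by
      rw [hQ, hD]
      field_simp
      ring
    have hQD' : Q ^ 2 + D ^ 2 = 2 * ((bb ^ 2 + (bb⁻¹) ^ 2 : ℝ) : ℂ) := by
      rw [hQ, hD]
      push_cast
      ring
    have hnum : (2 * w ^ 2 * (Complex.cosh (2 * Complex.I * z * w) -
      (1 + (2 * Complex.I * z * w) ^ 2 / 2 + (2 * Complex.I * z * w) ^ 4 / 24)) -
      (1 + 2 * B * w ^ 2) * ((Complex.cosh (Q * w) - (1 + (Q * w) ^ 2 / 2 + (Q * w) ^ 4 / 24)) -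
      (Complex.cosh (D * w) - (1 + (D * w) ^ 2 / 2 + (D * w) ^ 4 / 24))) +
      (4 / 3 * z ^ 4 - 2 / 3 * B * ((bb ^ 2 + (bb⁻¹) ^ 2 : ℝ) : ℂ)) * w ^ 6) =
      2 * w ^ 2 * Complex.cosh (2 * Complex.I * z * w) - (2 + 4 * B * w ^ 2) *
        (Complex.sinh (bb * w) * Complex.sinh ((bb : ℂ)⁻¹ * w)) := by
      have e2 : (2 * Complex.I * z * w) ^ 2 = -4 * z ^ 2 * w ^ 2 := by
        linear_combination 4 * z ^ 2 * w ^ 2 * Complex.I_sq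
      have e4 : (2 * Complex.I * z * w) ^ 4 = 16 * z ^ 4 * w ^ 4 := by
        linear_combination 16 * z ^ 4 * w ^ 4 * Complex.I_pow_four
      rw [e2, e4]
      linear_combination (-(1 + 2 * B * w ^ 2)) * hS +
        (1 + 2 * B * w ^ 2) * (w ^ 2 / 2 + w ^ 4 * (Q ^ 2 + D ^ 2) / 24) * hQD +
        (1 + 2 * B * w ^ 2) * w ^ 4 / 6 * hQD' + 4 * w ^ 4 * hB
    rw [hnum]
    generalize Complex.sinh (bb * w) = p at *
    generalize Complex.sinh ((bb : ℂ)⁻¹ * w) = q at *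
    generalize Complex.cosh (2 * Complex.I * z * w) = r at *
    clear_value B
    field_simp
    ring
  · have : (fun w : ℂ => w ^ 6 * w⁻¹ * w⁻¹ * (4 * w ^ 3)⁻¹) =ᶠ[𝓝[≠] 0] fun w => w / 4 := by
      filter_upwards [self_mem_nhdsWithin] with w hw
      have hw : w ≠ 0 := hw
      field_simp
    refine this.trans_isBigO ?_
    have hc : Continuous fun w : ℂ => w / 4 := by fun_prop
    exact ((hc.tendsto 0).isBigO_one ℝ).mono nhdsWithin_le_nhds

theorem norm_sinh_mul_ge {bb : ℝ} (hbb : 0 < bb) {x : ℝ} (hx : 1 ≤ |x|) (v : ℝ) :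
    (1 - Real.exp (-2 * bb)) / 2 * Real.exp (bb * |x|) ≤
      ‖Complex.sinh ((x + v * Complex.I) * bb)‖ := by
  have h := mul_exp_le_norm_sinh (u₀ := bb) (u := x * bb) (v * bb) (by
    rw [abs_mul, abs_of_pos hbb]
    nlinarith)
  rw [abs_mul, abs_of_pos hbb, mul_comm |x|] at h
  convert h using 3
  push_cast
  ring

theorem one_sub_exp_neg_pos {bb : ℝ} (hbb : 0 < bb) : 0 < 1 - Real.exp (-2 * bb) := by
  have : Real.exp (-2 * bb) < 1 := by
    rw [Real.exp_lt_one_iff]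
    linarith
  linarith

theorem norm_phiKer_le_of_one_le_abs {bb : ℝ} (hbb : 0 < bb) (z : ℂ) (V : ℝ) :
    ∃ C : ℝ, ∀ x v : ℝ, 1 ≤ |x| → |v| ≤ V → ‖phiKer bb z (x + v * Complex.I)‖ ≤
      C * Real.exp (-(bb + bb⁻¹ - 2 * |z.im|) * |x|) := by
  have hbi : 0 < bb⁻¹ := inv_pos.mpr hbb
  have p1 := one_sub_exp_neg_pos hbb
  have p2 := one_sub_exp_neg_pos hbi
  refine ⟨Real.exp (2 * |z.re| * V) *
    ((1 - Real.exp (-2 * bb)) * (1 - Real.exp (-2 * bb⁻¹)))⁻¹, fun x v hx hv => ?_⟩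
  have h1 : ‖Complex.exp (-2 * Complex.I * z * (x + v * Complex.I))‖ ≤
      Real.exp (2 * |z.re| * V + 2 * |z.im| * |x|) := by
    rw [Complex.norm_exp, Real.exp_le_exp]
    simp
    have a1 : z.im * x ≤ |z.im| * |x| := by
      rw [← abs_mul]
      exact le_abs_self _
    have a2 : z.re * v ≤ |z.re| * |v| := by
      rw [← abs_mul]
      exact le_abs_self _
    have a3 : |z.re| * |v| ≤ |z.re| * V := by gcongr
    linarith
  have hw : 1 ≤ ‖(x + v * Complex.I : ℂ)‖ := by
    refine hx.trans (le_trans ?_ (Complex.abs_re_le_norm _))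
    simp
  have key : (1 - Real.exp (-2 * bb)) * (1 - Real.exp (-2 * bb⁻¹)) *
      Real.exp ((bb + bb⁻¹) * |x|) ≤ ‖4 * Complex.sinh ((x + v * Complex.I) * bb) *
      Complex.sinh ((x + v * Complex.I) / bb) * (x + v * Complex.I)‖ := by
    rw [norm_mul, norm_mul, norm_mul]
    have s2 := norm_sinh_mul_ge hbi hx v
    rw [Complex.ofReal_inv, ← div_eq_mul_inv (_ : ℂ)] at s2
    calc _ = 4 * ((1 - Real.exp (-2 * bb)) / 2 * Real.exp (bb * |x|)) *
          ((1 - Real.exp (-2 * bb⁻¹)) / 2 * Real.exp (bb⁻¹ * |x|)) * 1 := by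
          rw [add_mul, Real.exp_add]
          ring
      _ ≤ _ := by
          rw [show ‖(4 : ℂ)‖ = 4 by norm_num]
          gcongr
          exact norm_sinh_mul_ge hbb hx v
  rw [phiKer, norm_div]
  refine (div_le_div₀ (Real.exp_nonneg _) h1 (by positivity) key).trans (le_of_eq ?_)
  rw [Real.exp_add, show -(bb + bb⁻¹ - 2 * |z.im|) * |x| =
    2 * |z.im| * |x| + -((bb + bb⁻¹) * |x|) by ring, Real.exp_add, Real.exp_neg]
  field_simp

theorem phiKer_neg_right (bb : ℝ) (z w : ℂ) : phiKer bb z (-w) = -phiKer bb (-z) w := by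
  rw [phiKer, phiKer, neg_mul w, neg_div (bb : ℂ) w, Complex.sinh_neg, Complex.sinh_neg, ← div_neg]
  congr 1
  · congr 1
    ring
  · ring

theorem differentiableAt_phiKer {bb : ℝ} (hbb : 0 < bb) (z : ℂ) {w : ℂ} (hw : w ≠ 0)
    (him : |w.im| ≤ contourHeight bb) : DifferentiableAt ℂ (phiKer bb z) w := by
  have hb : (bb : ℂ) ≠ 0 := by exact_mod_cast hbb.ne'
  have s1 : Complex.sinh (w * bb) ≠ 0 := by
    refine sinh_ne_zero_of_abs_im_lt (mul_ne_zero hw hb) ?_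
    have := contourHeight_mul_le hbb
    simp only [Complex.im_mul_ofReal, abs_mul, abs_of_pos hbb]
    nlinarith [Real.pi_pos]
  have s2 : Complex.sinh (w / bb) ≠ 0 := by
    refine sinh_ne_zero_of_abs_im_lt (div_ne_zero hw hb) ?_
    have := contourHeight_div_le hbb
    rw [Complex.div_ofReal_im, abs_div, abs_of_pos hbb]
    have : |w.im| / bb ≤ contourHeight bb / bb := by gcongr
    linarith [Real.pi_pos]
  have h : 4 * Complex.sinh (w * bb) * Complex.sinh (w / bb) * w ≠ 0 := by
    simp [s1, s2, hw]
  unfold phiKer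
  fun_prop (disch := assumption)

/-- The inversion relation for `log Φ_𝖻`. -/
theorem logPhi_add_logPhi_neg {bb : ℝ} (hbb : 0 < bb) {z : ℂ} (hz : |z.im| < (bb + bb⁻¹) / 2) :
    logPhi bb z + logPhi bb (-z) =
      Complex.I * π * (z ^ 2 + ((bb ^ 2 + (bb⁻¹) ^ 2 : ℝ) : ℂ) / 12) := by
  have hε := contourHeight_pos hbb
  have hz' : |(-z).im| < (bb + bb⁻¹) / 2 := by simpa using hz
  obtain ⟨C₁, hC₁⟩ := norm_phiKer_le_of_one_le_abs hbb z (contourHeight bb)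
  obtain ⟨C₂, hC₂⟩ := norm_phiKer_le_of_one_le_abs hbb (-z) (contourHeight bb)
  have key := integral_horizontal_sub_eq_residue (f := fun w => phiKer bb z w + phiKer bb (-z) w)
    (neg_lt_zero.mpr hε) hε (1 / 2) (-z ^ 2 - ((bb ^ 2 + (bb⁻¹) ^ 2 : ℝ) : ℂ) / 12)
    (fun w h1 h2 hw => (differentiableAt_phiKer hbb z hw (abs_le.mpr ⟨h1, h2⟩)).add
      (differentiableAt_phiKer hbb (-z) hw (abs_le.mpr ⟨h1, h2⟩)))
    (C := C₁ + C₂) (δ := bb + bb⁻¹ - 2 * |z.im|) (by linarith)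
    (fun x v hx h1 h2 => by
      refine (norm_add_le _ _).trans ?_
      rw [add_mul]
      have := hC₂ x v hx (abs_le.mpr ⟨h1, h2⟩)
      rw [Complex.neg_im, abs_neg] at this
      exact add_le_add (hC₁ x v hx (abs_le.mpr ⟨h1, h2⟩)) this)
    (phiKer_add_sub_isBigO hbb z)
  have hsum : ∫ x : ℝ, (phiKer bb z (x + contourHeight bb * Complex.I) +
      phiKer bb (-z) (x + contourHeight bb * Complex.I)) = logPhi bb z + logPhi bb (-z) :=
    integral_add (integrable_phiKer hbb hz) (integrable_phiKer hbb hz')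
  have hneg : ∫ x : ℝ, (phiKer bb z (x + (-contourHeight bb : ℝ) * Complex.I) +
      phiKer bb (-z) (x + (-contourHeight bb : ℝ) * Complex.I)) =
      -(logPhi bb z + logPhi bb (-z)) := by
    rw [← hsum, ← integral_neg, ← integral_neg_eq_self]
    congr 1
    funext x
    rw [show (((-x : ℝ) : ℂ) + (-contourHeight bb : ℝ) * Complex.I) =
      -(x + contourHeight bb * Complex.I) by push_cast; ring, phiKer_neg_right, phiKer_neg_right,
      neg_neg]
    ring
  simp only [hneg, hsum] at key
  linear_combination (-1 / 2) * key

theorem exp_div_sinh_sub_isBigO {bb : ℝ} (hbb : 0 < bb) (z : ℂ) :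
    (fun w => Complex.exp (-2 * Complex.I * z * w) / Complex.sinh (w / bb) - (0 : ℂ) / w ^ 3 -
      (bb : ℂ) / w) =O[𝓝[≠] 0] fun _ => (1 : ℝ) := by
  have hb : (bb : ℂ) ≠ 0 := by exact_mod_cast hbb.ne'
  have r1 := exp_mul_sub_sum_isBigO (-2 * Complex.I * z) 1
  have r2 := sinh_mul_sub_isBigO ((bb : ℂ)⁻¹)
  have N : (fun w : ℂ => w * (Complex.exp (-2 * Complex.I * z * w) -
      ∑ i ∈ Finset.range 1, (-2 * Complex.I * z * w) ^ i / (i.factorial : ℂ)) -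
      bb * (Complex.sinh ((bb : ℂ)⁻¹ * w) - (bb : ℂ)⁻¹ * w)) =O[𝓝 0] fun w => w ^ 2 := by
    refine (?_ : _ =O[_] _).sub (r2.const_mul_left _)
    refine ((Asymptotics.isBigO_refl (fun w : ℂ => w) (𝓝 0)).mul r1).congr_right fun w => ?_
    ring
  have i2 := sinh_mul_inv_isBigO (inv_ne_zero hb)
  have key := (N.mul i2).mono (nhdsWithin_le_nhds (s := {0}ᶜ))
  have key2 := key.mul (Asymptotics.isBigO_refl (fun w : ℂ => w⁻¹) (𝓝[≠] 0))
  refine (key2.congr' ?_ (EventuallyEq.refl _ _)).trans ?_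
  · filter_upwards [self_mem_nhdsWithin,
      nhdsWithin_le_nhds (s := {0}ᶜ) (Metric.ball_mem_nhds (0 : ℂ) (contourHeight_pos hbb))]
      with w hw hwb
    have hw : w ≠ 0 := hw
    have him : |w.im| < contourHeight bb :=
      lt_of_le_of_lt (Complex.abs_im_le_norm _) (by simpa using hwb)
    have s2 : Complex.sinh ((bb : ℂ)⁻¹ * w) ≠ 0 := by
      refine sinh_ne_zero_of_abs_im_lt (mul_ne_zero (inv_ne_zero hb) hw) ?_
      have := contourHeight_div_le hbb
      rw [← Complex.ofReal_inv]
      simp only [Complex.im_ofReal_mul, abs_mul, abs_of_pos (inv_pos.mpr hbb)]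
      rw [← div_eq_inv_mul]
      have : |w.im| / bb < contourHeight bb / bb := by gcongr
      linarith [Real.pi_pos]
    have e : w / (bb : ℂ) = (bb : ℂ)⁻¹ * w := by ring
    rw [e]
    generalize Complex.sinh ((bb : ℂ)⁻¹ * w) = q at *
    simp
    field_simp
    ring
  · have : (fun w : ℂ => w ^ 2 * w⁻¹ * w⁻¹) =ᶠ[𝓝[≠] 0] fun w => 1 := by
      filter_upwards [self_mem_nhdsWithin] with w hw
      have hw : w ≠ 0 := hw
      field_simp
    refine this.trans_isBigO ?_
    exact Asymptotics.isBigO_const_const _ one_ne_zero _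

theorem integral_exp_div_sinh {bb : ℝ} (hbb : 0 < bb) {z : ℂ} (hz : |z.im| < 1 / (2 * bb)) :
    (∫ t : ℝ, Complex.exp (-2 * Complex.I * z * (t + contourHeight bb * Complex.I)) /
      Complex.sinh ((t + contourHeight bb * Complex.I) / bb)) *
      (1 + Complex.exp (-2 * π * bb * z)) = -2 * π * Complex.I * bb := by
  have hb : (bb : ℂ) ≠ 0 := by exact_mod_cast hbb.ne'
  have hε := contourHeight_pos hbb
  have hbi : 0 < bb⁻¹ := inv_pos.mpr hbb
  have hεb : contourHeight bb ≤ π * bb / 2 := by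
    have := contourHeight_div_le hbb
    rw [div_le_iff₀ hbb] at this
    linarith
  have hπb : 0 < π * bb := by positivity
  have p2 := one_sub_exp_neg_pos hbi
  have hδ : 0 < bb⁻¹ - 2 * |z.im| := by
    rw [one_div, mul_inv] at hz
    linarith
  have key := integral_horizontal_sub_eq_residue
    (f := fun w => Complex.exp (-2 * Complex.I * z * w) / Complex.sinh (w / bb))
    (v₁ := contourHeight bb - π * bb) (by linarith) hε 0 bb
    (fun w h1 h2 hw => by
      have s2 : Complex.sinh (w / bb) ≠ 0 := by
        refine sinh_ne_zero_of_abs_im_lt (div_ne_zero hw hb) ?_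
        rw [Complex.div_ofReal_im, abs_div, abs_of_pos hbb, div_lt_iff₀ hbb, abs_lt]
        constructor <;> linarith
      fun_prop (disch := assumption))
    (C := Real.exp (2 * |z.re| * (π * bb)) * ((1 - Real.exp (-2 * bb⁻¹)) / 2)⁻¹)
    (δ := bb⁻¹ - 2 * |z.im|) hδ
    (fun x v hx hv1 hv2 => by
      have h1 : ‖Complex.exp (-2 * Complex.I * z * (x + v * Complex.I))‖ ≤
          Real.exp (2 * |z.re| * (π * bb) + 2 * |z.im| * |x|) := by
        rw [Complex.norm_exp, Real.exp_le_exp]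
        simp
        have a1 : z.im * x ≤ |z.im| * |x| := by
          rw [← abs_mul]
          exact le_abs_self _
        have a2 : z.re * v ≤ |z.re| * |v| := by
          rw [← abs_mul]
          exact le_abs_self _
        have a3 : |z.re| * |v| ≤ |z.re| * (π * bb) := by
          gcongr
          rw [abs_le]
          constructor <;> linarith
        linarith
      have s2 := norm_sinh_mul_ge hbi hx v
      rw [Complex.ofReal_inv, ← div_eq_mul_inv (_ : ℂ)] at s2
      rw [norm_div]
      refine (div_le_div₀ (Real.exp_nonneg _) h1 (by positivity) s2).trans (le_of_eq ?_)
      rw [Real.exp_add, show -(bb⁻¹ - 2 * |z.im|) * |x| =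
        2 * |z.im| * |x| + -(bb⁻¹ * |x|) by ring, Real.exp_add, Real.exp_neg]
      field_simp)
    (exp_div_sinh_sub_isBigO hbb z)
  have shift : ∫ t : ℝ, Complex.exp (-2 * Complex.I * z *
      (t + (contourHeight bb - π * bb : ℝ) * Complex.I)) /
      Complex.sinh ((t + (contourHeight bb - π * bb : ℝ) * Complex.I) / bb) =
      -Complex.exp (-2 * π * bb * z) * ∫ t : ℝ,
      Complex.exp (-2 * Complex.I * z * (t + contourHeight bb * Complex.I)) /
      Complex.sinh ((t + contourHeight bb * Complex.I) / bb) := by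
    rw [← integral_const_mul]
    congr 1
    funext t
    have e1 : Complex.sinh ((t + (contourHeight bb - π * bb : ℝ) * Complex.I) / bb) =
        -Complex.sinh ((t + contourHeight bb * Complex.I) / bb) := by
      rw [← Complex.sinh_sub_pi_mul_I]
      congr 1
      push_cast
      field_simp
      ring
    have e2 : Complex.exp (-2 * Complex.I * z *
        (t + (contourHeight bb - π * bb : ℝ) * Complex.I)) = Complex.exp (-2 * π * bb * z) *
        Complex.exp (-2 * Complex.I * z * (t + contourHeight bb * Complex.I)) := by
      rw [← Complex.exp_add]
      congr 1
      push_cast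
      linear_combination 2 * z * π * bb * Complex.I_sq
    rw [e1, e2]
    ring
  rw [shift] at key
  linear_combination -key

theorem abs_im_shift_lt {bb : ℝ} (hbb : 0 < bb) {z : ℂ} (hz : |z.im| < 1 / (2 * bb)) :
    |(z - Complex.I * bb / 2).im| < (bb + bb⁻¹) / 2 ∧
      |(z + Complex.I * bb / 2).im| < (bb + bb⁻¹) / 2 := by
  have hz2 : |z.im| + bb / 2 < (bb + bb⁻¹) / 2 := by
    rw [one_div, mul_inv] at hz
    linarith
  constructor
  · refine lt_of_le_of_lt ?_ hz2
    have : (z - Complex.I * bb / 2).im = z.im - bb / 2 := by simp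
    rw [this]
    refine (abs_sub _ _).trans ?_
    rw [abs_of_pos (by positivity : 0 < bb / 2)]
  · refine lt_of_le_of_lt ?_ hz2
    have : (z + Complex.I * bb / 2).im = z.im + bb / 2 := by simp
    rw [this]
    refine (abs_add_le _ _).trans ?_
    rw [abs_of_pos (by positivity : 0 < bb / 2)]

theorem logPhi_sub_logPhi {bb : ℝ} (hbb : 0 < bb) {z : ℂ} (hz : |z.im| < 1 / (2 * bb)) :
    logPhi bb (z - Complex.I * bb / 2) - logPhi bb (z + Complex.I * bb / 2) =
      ∫ t : ℝ, (-(2 * Complex.sinh ((t + contourHeight bb * Complex.I) / bb) *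
        (t + contourHeight bb * Complex.I))⁻¹) *
        Complex.exp (-Complex.I * (2 : ℝ) * z * (t + contourHeight bb * Complex.I)) := by
  obtain ⟨i1, i2⟩ := abs_im_shift_lt hbb hz
  rw [logPhi, logPhi, ← integral_sub (integrable_phiKer hbb i1) (integrable_phiKer hbb i2)]
  congr 1
  funext t
  have hden := contour_den_ne_zero hbb t
  set w : ℂ := t + contourHeight bb * Complex.I
  have s1 : Complex.sinh (w * bb) ≠ 0 := by
    intro h
    simp [h] at hden
  have s2 : Complex.sinh (w / bb) ≠ 0 := by
    intro h
    simp [h] at hden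
  have hw : w ≠ 0 := by
    intro h
    simp [h] at hden
  have e1 : Complex.exp (-2 * Complex.I * (z - Complex.I * bb / 2) * w) =
      Complex.exp (-Complex.I * (2 : ℝ) * z * w) * Complex.exp (-(w * bb)) := by
    rw [← Complex.exp_add]
    congr 1
    push_cast
    linear_combination bb * w * Complex.I_sq
  have e2 : Complex.exp (-2 * Complex.I * (z + Complex.I * bb / 2) * w) =
      Complex.exp (-Complex.I * (2 : ℝ) * z * w) * Complex.exp (w * bb) := by
    rw [← Complex.exp_add]
    congr 1
    push_cast
    linear_combination (-bb * w) * Complex.I_sq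
  have e3 : Complex.exp (w * bb) = Complex.exp (-(w * bb)) + 2 * Complex.sinh (w * bb) := by
    rw [Complex.sinh]
    ring
  rw [phiKer, phiKer, e1, e2, e3]
  generalize Complex.sinh (w * bb) = p at *
  generalize Complex.sinh (w / bb) = q at *
  field_simp
  ring

theorem hasDerivAt_logPhi_sub_logPhi {bb : ℝ} (hbb : 0 < bb) {z : ℂ} (hz : |z.im| < 1 / (2 * bb)) :
    ∃ d : ℂ, d * (1 + Complex.exp (2 * π * bb * z)) = 2 * π * bb * Complex.exp (2 * π * bb * z) ∧
      HasDerivAt (fun z => logPhi bb (z - Complex.I * bb / 2) - logPhi bb (z + Complex.I * bb / 2))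
        d z := by
  have hε := contourHeight_pos hbb
  have hs := sin_contourHeight_div_pos hbb
  have hsne : ∀ t : ℝ, Complex.sinh ((t + contourHeight bb * Complex.I) / bb) ≠ 0 := fun t => by
    rw [← norm_pos_iff]
    exact lt_of_lt_of_le (by positivity) (norm_sinh_div_contour_ge hbb t)
  have hden : ∀ t : ℝ, 2 * Complex.sinh ((t + contourHeight bb * Complex.I) / bb) *
        (t + contourHeight bb * Complex.I) ≠ 0 := fun t =>
    mul_ne_zero (mul_ne_zero two_ne_zero (hsne t)) (add_mul_I_ne_zero hε.ne' t)
  have hδ : 0 < bb⁻¹ - 2 * |z.im| := by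
    rw [one_div, mul_inv] at hz
    linarith
  have hc : Continuous fun t : ℝ => -(2 * Complex.sinh ((t + contourHeight bb * Complex.I) / bb) *
        (t + contourHeight bb * Complex.I))⁻¹ := by
    refine (Continuous.inv₀ ?_ hden).neg
    simp only [div_eq_mul_inv]
    fun_prop
  have h := (hasDerivAt_fourierLaplace_line hc 2 (contourHeight bb) z
    (C := (contourHeight bb * Real.sin (contourHeight bb / bb))⁻¹) hδ (fun t => by
      have h1 : ‖-(2 * Complex.sinh ((t + contourHeight bb * Complex.I) / bb) *
          (t + contourHeight bb * Complex.I))⁻¹‖ ≤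
          (contourHeight bb * Real.sin (contourHeight bb / bb))⁻¹ * Real.exp (-bb⁻¹ * |t|) := by
        rw [norm_neg, norm_inv, norm_mul, norm_mul, neg_mul, Real.exp_neg, ← mul_inv]
        refine inv_anti₀ (by positivity) ?_
        calc _ = 2 * (Real.sin (contourHeight bb / bb) * Real.exp (bb⁻¹ * |t|) / 2) *
              contourHeight bb := by ring
          _ ≤ _ := by
            rw [show ‖(2 : ℂ)‖ = 2 by norm_num]
            gcongr
            · exact norm_sinh_div_contour_ge hbb t
            · exact contourHeight_le_norm bb t
      have h2 : Real.exp (2 * z.im * t) ≤ Real.exp (2 * |z.im| * |t|) := by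
        rw [Real.exp_le_exp]
        have : z.im * t ≤ |z.im| * |t| := by
          rw [← abs_mul]
          exact le_abs_self _
        linarith
      refine (mul_le_mul h1 h2 (Real.exp_nonneg _) (by positivity)).trans (le_of_eq ?_)
      rw [mul_assoc, ← Real.exp_add]
      congr 2
      ring)).2
  refine ⟨_, ?_, h.congr_of_eventuallyEq ?_⟩
  · have e : ∫ t : ℝ, (-(2 * Complex.sinh ((t + contourHeight bb * Complex.I) / bb) *
          (t + contourHeight bb * Complex.I))⁻¹) * (-Complex.I * (2 : ℝ) *
          (t + contourHeight bb * Complex.I) * Complex.exp (-Complex.I * (2 : ℝ) * z *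
          (t + contourHeight bb * Complex.I))) = Complex.I * ∫ t : ℝ,
        Complex.exp (-2 * Complex.I * z * (t + contourHeight bb * Complex.I)) /
        Complex.sinh ((t + contourHeight bb * Complex.I) / bb) := by
      rw [← integral_const_mul]
      congr 1
      funext t
      have h1 := hsne t
      have h2 := add_mul_I_ne_zero hε.ne' t
      rw [show -Complex.I * (2 : ℝ) * z * (t + contourHeight bb * Complex.I) =
        -2 * Complex.I * z * (t + contourHeight bb * Complex.I) by push_cast; ring]
      set w : ℂ := t + contourHeight bb * Complex.I
      generalize Complex.sinh (w / bb) = q at *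
      push_cast
      field_simp
    rw [e]
    have J := integral_exp_div_sinh hbb hz
    have hexp : Complex.exp (-2 * π * bb * z) * Complex.exp (2 * π * bb * z) = 1 := by
      rw [← Complex.exp_add, ← Complex.exp_zero]
      congr 1
      ring
    set j := ∫ t : ℝ, Complex.exp (-2 * Complex.I * z * (t + contourHeight bb * Complex.I)) /
        Complex.sinh ((t + contourHeight bb * Complex.I) / bb)
    linear_combination Complex.I * Complex.exp (2 * π * bb * z) * J - Complex.I * j * hexp -
      2 * π * bb * Complex.exp (2 * π * bb * z) * Complex.I_sq
  · have : {z : ℂ | |z.im| < 1 / (2 * bb)} ∈ 𝓝 z :=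
      (isOpen_lt (by fun_prop) continuous_const).mem_nhds hz
    filter_upwards [this] with w hw using logPhi_sub_logPhi hbb hw

/-- The functional equation of Faddeev's quantum dilogarithm inside the strip. -/
theorem PhiS_functional {bb : ℝ} (hbb : 0 < bb) {z : ℂ} (hz : |z.im| < 1 / (2 * bb)) :
    PhiS bb (z - Complex.I * bb / 2) =
      (1 + Complex.exp (2 * π * bb * z)) * PhiS bb (z + Complex.I * bb / 2) := by
  set k : ℂ → ℂ := fun z =>
    logPhi bb (z - Complex.I * bb / 2) - logPhi bb (z + Complex.I * bb / 2) with hk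
  set L : ℝ → ℂ := fun x => x + z.im * Complex.I with hL
  have him : ∀ x, (L x).im = z.im := fun x => by simp [hL]
  have hre : ∀ x, (L x).re = x := fun x => by simp [hL]
  have hLd : ∀ x, HasDerivAt L 1 x := fun x => by
    have h1 : HasDerivAt (fun x : ℝ => (x : ℂ)) 1 x := Complex.ofRealCLM.hasDerivAt
    exact h1.add_const (z.im * Complex.I)
  set h : ℝ → ℂ := fun x => Complex.exp (-k (L x)) * (1 + Complex.exp (2 * π * bb * L x)) with hh
  have hd : ∀ x, HasDerivAt h 0 x := fun x => by
    obtain ⟨d, h1, h2⟩ := hasDerivAt_logPhi_sub_logPhi hbb (z := L x) (by rw [him]; exact hz)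
    have h3 : HasDerivAt (fun x => k (L x)) (d * 1) x := h2.comp x (hLd x)
    have h4 := ((hLd x).const_mul (2 * π * bb : ℂ)).cexp.const_add 1
    refine (h3.neg.cexp.mul h4).congr_deriv ?_
    simp only [Pi.neg_apply]
    linear_combination (-Complex.exp (-k (L x))) * h1
  have hconst : ∀ x y, h x = h y := is_const_of_deriv_eq_zero
    (fun x => (hd x).differentiableAt) (fun x => (hd x).deriv)
  have hlog : ∀ s : ℂ, (∀ x, |(L x + s).im| < (bb + bb⁻¹) / 2) →
      Tendsto (fun x => logPhi bb (L x + s)) atBot (𝓝 0) := fun s hs => by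
    have hε := contourHeight_pos hbb
    have e : Tendsto (fun x : ℝ => kerBound bb * (2 / (bb + bb⁻¹ - 2 * |z.im + s.im|)) *
        Real.exp (2 * contourHeight bb * (x + s.re))) atBot (𝓝 0) := by
      have : Tendsto (fun x : ℝ => 2 * contourHeight bb * (x + s.re)) atBot atBot :=
        (tendsto_atBot_add_const_right _ _ tendsto_id).const_mul_atBot (by positivity)
      simpa using (Real.tendsto_exp_atBot.comp this).const_mul
        (kerBound bb * (2 / (bb + bb⁻¹ - 2 * |z.im + s.im|)))
    refine squeeze_zero_norm (fun x => ?_) e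
    have := norm_logPhi_le hbb (hs x)
    rwa [Complex.add_im, Complex.add_re, him, hre] at this
  have hk0 : Tendsto (fun x => k (L x)) atBot (𝓝 0) := by
    have h1 := hlog (-(Complex.I * bb / 2)) (fun x => by
      rw [← sub_eq_add_neg]
      exact (abs_im_shift_lt hbb (by rw [him]; exact hz)).1)
    have h2 := hlog (Complex.I * bb / 2) (fun x =>
      (abs_im_shift_lt hbb (by rw [him]; exact hz)).2)
    simpa [hk, sub_eq_add_neg] using h1.sub h2
  have hE : Tendsto (fun x => Complex.exp (2 * π * bb * L x)) atBot (𝓝 0) := by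
    rw [tendsto_zero_iff_norm_tendsto_zero]
    have : Tendsto (fun x : ℝ => 2 * π * bb * x) atBot atBot :=
      tendsto_id.const_mul_atBot (by positivity)
    refine (Real.tendsto_exp_atBot.comp this).congr fun x => ?_
    rw [Complex.norm_exp, Function.comp]
    congr 1
    simp [hL]
  have hlim : Tendsto h atBot (𝓝 1) := by
    have h1 := (Complex.continuous_exp.tendsto _).comp hk0.neg
    simpa [hh, Function.comp_def] using h1.mul (hE.const_add 1)
  have hone : h z.re = 1 := by
    refine tendsto_nhds_unique ?_ hlim
    refine (tendsto_const_nhds (x := h z.re)).congr fun x => hconst _ _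
  have hLz : L z.re = z := by simp [hL]
  rw [hh] at hone
  simp only [hLz] at hone
  rw [PhiS_eq_exp_logPhi, PhiS_eq_exp_logPhi]
  have e1 : Complex.exp (logPhi bb (z - Complex.I * bb / 2)) =
      Complex.exp (k z) * Complex.exp (logPhi bb (z + Complex.I * bb / 2)) := by
    rw [← Complex.exp_add, hk]
    congr 1
    ring
  have e2 : Complex.exp (k z) * Complex.exp (-k z) = 1 := by
    rw [← Complex.exp_add, add_neg_cancel, Complex.exp_zero]
  rw [e1]
  linear_combination (-Complex.exp (k z) * Complex.exp (logPhi bb (z + Complex.I * bb / 2))) * hone +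
    (1 + Complex.exp (2 * π * bb * z)) * Complex.exp (logPhi bb (z + Complex.I * bb / 2)) * e2

theorem PhiS_inv_param (bb : ℝ) (z : ℂ) : PhiS bb⁻¹ z = PhiS bb z := by
  unfold PhiS phiKer
  simp only [inv_inv, Complex.ofReal_inv, div_inv_eq_mul, min_comm bb⁻¹ bb, ← div_eq_mul_inv]
  congr 2
  funext t
  congr 1
  ring

theorem PhiS_ne_zero (bb : ℝ) (z : ℂ) : PhiS bb z ≠ 0 := Complex.exp_ne_zero _

theorem differentiableAt_PhiS {bb : ℝ} (hbb : 0 < bb) {z : ℂ} (hz : |z.im| < (bb + bb⁻¹) / 2) :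
    DifferentiableAt ℂ (PhiS bb) z := by
  have h : PhiS bb = fun z => Complex.exp (logPhi bb z) := funext (PhiS_eq_exp_logPhi bb)
  rw [h]
  exact (differentiableAt_logPhi hbb hz).cexp

/-- A bound for `Φ_𝖻` and its inverse on the left half of the strip `|Im z| ≤ Y`. -/
def stripBound (bb Y : ℝ) : ℝ := Real.exp (kerBound bb * (2 / (bb + bb⁻¹ - 2 * Y)))

theorem stripBound_pos (bb Y : ℝ) : 0 < stripBound bb Y := Real.exp_pos _

theorem exp_norm_logPhi_le {bb : ℝ} (hbb : 0 < bb) {z : ℂ} {Y : ℝ} (hzY : |z.im| ≤ Y)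
    (hY : Y < (bb + bb⁻¹) / 2) (hre : z.re ≤ 0) : Real.exp ‖logPhi bb z‖ ≤ stripBound bb Y := by
  have hk := kerBound_pos hbb
  have hε := contourHeight_pos hbb
  rw [stripBound, Real.exp_le_exp]
  refine (norm_logPhi_le hbb (hzY.trans_lt hY)).trans ?_
  have h1 : Real.exp (2 * contourHeight bb * z.re) ≤ 1 := by
    rw [Real.exp_le_one_iff]
    nlinarith
  calc _ ≤ kerBound bb * (2 / (bb + bb⁻¹ - 2 * |z.im|)) * 1 := by
        gcongr
        have : 0 < bb + bb⁻¹ - 2 * |z.im| := by linarith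
        positivity
    _ ≤ _ := by
        rw [mul_one]
        gcongr
        linarith

theorem norm_PhiS_inv_le {bb : ℝ} (hbb : 0 < bb) {z : ℂ} {Y : ℝ} (hzY : |z.im| ≤ Y)
    (hY : Y < (bb + bb⁻¹) / 2) :
    ‖(PhiS bb z)⁻¹‖ ≤ stripBound bb Y * Real.exp (2 * π * z.im * max z.re 0) := by
  rw [PhiS_eq_exp_logPhi, ← Complex.exp_neg]
  rcases le_total z.re 0 with h | h
  · rw [max_eq_right h, mul_zero, Real.exp_zero, mul_one]
    refine le_trans ?_ (exp_norm_logPhi_le hbb hzY hY h)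
    rw [Complex.norm_exp, Real.exp_le_exp]
    refine (Complex.re_le_norm _).trans ?_
    rw [norm_neg]
  · rw [max_eq_left h]
    have hinv := logPhi_add_logPhi_neg hbb (hzY.trans_lt hY)
    have e : -logPhi bb z = logPhi bb (-z) -
        Complex.I * π * (z ^ 2 + ((bb ^ 2 + (bb⁻¹) ^ 2 : ℝ) : ℂ) / 12) := by
      rw [← hinv]
      ring
    have h2 := exp_norm_logPhi_le hbb (z := -z) (Y := Y) (by simpa using hzY) hY (by simpa using h)
    rw [e, sub_eq_add_neg, Complex.exp_add, norm_mul]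
    refine mul_le_mul ?_ (le_of_eq ?_) (norm_nonneg _) (stripBound_pos _ _).le
    · refine le_trans ?_ h2
      rw [Complex.norm_exp, Real.exp_le_exp]
      exact Complex.re_le_norm _
    · rw [Complex.norm_exp]
      congr 1
      have : ((((bb ^ 2 + (bb⁻¹) ^ 2 : ℝ) : ℂ) / 12)).im = 0 := by
        rw [← Complex.ofReal_ofNat, ← Complex.ofReal_div, Complex.ofReal_im]
      rw [mul_assoc, Complex.neg_re, Complex.I_mul_re, Complex.im_ofReal_mul, Complex.add_im, this]
      simp [pow_two]
      ring

theorem exp_neg_mul_mul_exp_le {y η : ℝ} (t : ℝ) :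
    Real.exp (-(2 * π) * y * t) * Real.exp (2 * π * -η * max t 0) ≤
      Real.exp (-(2 * π * min (-y) (η + y)) * |t|) := by
  rw [← Real.exp_add, Real.exp_le_exp]
  have hp := Real.pi_pos
  rcases le_total t 0 with h | h
  · rw [max_eq_right h, abs_of_nonpos h]
    have : min (-y) (η + y) * (-t) ≤ -y * -t := by
      gcongr
      · linarith
      · exact min_le_left _ _
    nlinarith
  · rw [max_eq_left h, abs_of_nonneg h]
    have : min (-y) (η + y) * t ≤ (η + y) * t := by
      gcongr
      exact min_le_right _ _
    nlinarith

/-- The integrand of the Fourier transform of `1 / Φ_𝖻`. -/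
def invPhiKer (bb : ℝ) (w u : ℂ) : ℂ := Complex.exp (2 * π * Complex.I * w * u) * (PhiS bb u)⁻¹

/-- The Fourier transform of `1 / Φ_𝖻` along the line `Im u = -η`. -/
def invPhiFT (bb η : ℝ) (w : ℂ) : ℂ :=
  ∫ t : ℝ, invPhiKer bb w (t + (-η : ℝ) * Complex.I)

theorem norm_invPhiKer_le {bb : ℝ} (hbb : 0 < bb) {η Y : ℝ} (hη : 0 < η) (hηY : η ≤ Y)
    (hY : Y < (bb + bb⁻¹) / 2) (w : ℂ) (t : ℝ) :
    ‖invPhiKer bb w (t + (-η : ℝ) * Complex.I)‖ ≤ stripBound bb Y * Real.exp (2 * π * η * w.re) *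
      Real.exp (-(2 * π * min (-w.im) (η + w.im)) * |t|) := by
  have h1 := norm_PhiS_inv_le hbb (z := t + (-η : ℝ) * Complex.I) (Y := Y)
    (by simpa [abs_of_pos hη] using hηY) hY
  have him : (t + (-η : ℝ) * Complex.I : ℂ).im = -η := by simp
  have hre : (t + (-η : ℝ) * Complex.I : ℂ).re = t := by simp
  rw [him, hre] at h1
  have h2 : ‖Complex.exp (2 * π * Complex.I * w * (t + (-η : ℝ) * Complex.I))‖ =
      Real.exp (2 * π * η * w.re) * Real.exp (-(2 * π) * w.im * t) := by
    rw [Complex.norm_exp, ← Real.exp_add]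
    congr 1
    simp
    ring
  have hs := stripBound_pos bb Y
  rw [invPhiKer, norm_mul, h2]
  calc _ ≤ Real.exp (2 * π * η * w.re) * Real.exp (-(2 * π) * w.im * t) *
        (stripBound bb Y * Real.exp (2 * π * -η * max t 0)) := by gcongr
    _ = stripBound bb Y * Real.exp (2 * π * η * w.re) *
        (Real.exp (-(2 * π) * w.im * t) * Real.exp (2 * π * -η * max t 0)) := by ring
    _ ≤ _ := by
      gcongr
      exact exp_neg_mul_mul_exp_le t

theorem differentiableAt_invPhiKer {bb : ℝ} (hbb : 0 < bb) (w : ℂ) {u : ℂ}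
    (hu : |u.im| < (bb + bb⁻¹) / 2) : DifferentiableAt ℂ (invPhiKer bb w) u := by
  have h1 := differentiableAt_PhiS hbb hu
  have h2 := PhiS_ne_zero bb u
  unfold invPhiKer
  fun_prop (disch := assumption)

theorem continuous_invPhiKer {bb : ℝ} (hbb : 0 < bb) (w : ℂ) {η : ℝ} (hη : 0 < η)
    (hηQ : η < (bb + bb⁻¹) / 2) :
    Continuous fun t : ℝ => invPhiKer bb w (t + (-η : ℝ) * Complex.I) :=
  continuous_horizontal_line fun z hz => (differentiableAt_invPhiKer hbb w (by
    rw [hz, abs_neg, abs_of_pos hη]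
    exact hηQ)).continuousAt

theorem integrable_invPhiKer {bb : ℝ} (hbb : 0 < bb) {w : ℂ} (hw : w.im < 0) {η : ℝ}
    (hwη : -w.im < η) (hηQ : η < (bb + bb⁻¹) / 2) :
    Integrable fun t : ℝ => invPhiKer bb w (t + (-η : ℝ) * Complex.I) := by
  have hη : 0 < η := by linarith
  have hδ : 0 < 2 * π * min (-w.im) (η + w.im) := by
    have : 0 < min (-w.im) (η + w.im) := lt_min (by linarith) (by linarith)
    positivity
  exact integrable_of_norm_le_exp (continuous_invPhiKer hbb w hη hηQ) hδ
    fun x _ => norm_invPhiKer_le hbb hη le_rfl hηQ w x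

theorem norm_invPhiFT_le {bb : ℝ} (hbb : 0 < bb) {w : ℂ} (hw : w.im < 0) {η : ℝ}
    (hwη : -w.im < η) (hηQ : η < (bb + bb⁻¹) / 2) :
    ‖invPhiFT bb η w‖ ≤ stripBound bb η * Real.exp (2 * π * η * w.re) *
      (2 / (2 * π * min (-w.im) (η + w.im))) := by
  have hη : 0 < η := by linarith
  have hδ : 0 < 2 * π * min (-w.im) (η + w.im) := by
    have : 0 < min (-w.im) (η + w.im) := lt_min (by linarith) (by linarith)
    positivity
  have h := norm_integral_le_of_norm_le
    ((integrable_exp_neg_mul_abs hδ).const_mul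
      (stripBound bb η * Real.exp (2 * π * η * w.re)))
    (Eventually.of_forall (norm_invPhiKer_le hbb hη le_rfl hηQ w))
  rwa [integral_const_mul, integral_exp_neg_mul_abs hδ] at h

theorem invPhiFT_eq_of_le {bb : ℝ} (hbb : 0 < bb) {w : ℂ} (hw : w.im < 0) {η₁ η₂ : ℝ}
    (h₁ : -w.im < η₁) (h₁₂ : η₁ ≤ η₂) (h₂ : η₂ < (bb + bb⁻¹) / 2) :
    invPhiFT bb η₁ w = invPhiFT bb η₂ w := by
  have hδ : 0 < 2 * π * min (-w.im) (η₁ + w.im) := by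
    have : 0 < min (-w.im) (η₁ + w.im) := lt_min (by linarith) (by linarith)
    positivity
  have hs := stripBound_pos bb η₂
  refine (integral_horizontal_line_eq (neg_le_neg h₁₂)
    (fun z hz1 hz2 => differentiableAt_invPhiKer hbb w ?_) hδ
    (C := stripBound bb η₂ * Real.exp (2 * π * η₂ * |w.re|)) fun x v hx hv1 hv2 => ?_).symm
  · rw [abs_lt]
    constructor <;> linarith
  · have hv : 0 < -v := by linarith
    have := norm_invPhiKer_le hbb (η := -v) (Y := η₂) hv (by linarith) h₂ w x
    rw [neg_neg] at this
    refine this.trans ?_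
    have hp := Real.pi_pos
    have hA : -v * w.re ≤ η₂ * |w.re| :=
      (mul_le_mul_of_nonneg_left (le_abs_self _) hv.le).trans
        (mul_le_mul_of_nonneg_right (by linarith) (abs_nonneg _))
    rw [mul_assoc (2 * π), mul_assoc (2 * π) η₂]
    gcongr
    linarith

theorem invPhiFT_eq {bb : ℝ} (hbb : 0 < bb) {w : ℂ} (hw : w.im < 0) {η₁ η₂ : ℝ}
    (h₁ : -w.im < η₁) (h₁' : η₁ < (bb + bb⁻¹) / 2) (h₂ : -w.im < η₂)
    (h₂' : η₂ < (bb + bb⁻¹) / 2) : invPhiFT bb η₁ w = invPhiFT bb η₂ w := by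
  rcases le_total η₁ η₂ with h | h
  · exact invPhiFT_eq_of_le hbb hw h₁ h h₂'
  · exact (invPhiFT_eq_of_le hbb hw h₂ h h₁').symm

theorem differentiableAt_invPhiFT {bb : ℝ} (hbb : 0 < bb) {w : ℂ} (hw : w.im < 0) {η : ℝ}
    (hwη : -w.im < η) (hηQ : η < (bb + bb⁻¹) / 2) : DifferentiableAt ℂ (invPhiFT bb η) w := by
  have hη : 0 < η := by linarith
  have hδ : 0 < 2 * π * min (-w.im) (η + w.im) := by
    have : 0 < min (-w.im) (η + w.im) := lt_min (by linarith) (by linarith)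
    positivity
  have hs := stripBound_pos bb η
  have hg : Continuous fun t : ℝ => (PhiS bb (t + (-η : ℝ) * Complex.I))⁻¹ := by
    simpa [invPhiKer] using continuous_invPhiKer hbb 0 hη hηQ
  have h := (hasDerivAt_fourierLaplace_line hg (-(2 * π)) (-η) w (C := stripBound bb η) hδ
    (fun t => by
      have h1 := norm_PhiS_inv_le hbb (z := t + (-η : ℝ) * Complex.I) (Y := η)
        (by simp [abs_of_pos hη]) hηQ
      have him : (t + (-η : ℝ) * Complex.I : ℂ).im = -η := by simp
      have hre : (t + (-η : ℝ) * Complex.I : ℂ).re = t := by simp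
      rw [him, hre] at h1
      calc _ ≤ stripBound bb η * Real.exp (2 * π * -η * max t 0) *
            Real.exp (-(2 * π) * w.im * t) := by gcongr
        _ = stripBound bb η * (Real.exp (-(2 * π) * w.im * t) *
            Real.exp (2 * π * -η * max t 0)) := by ring
        _ ≤ _ := by
          gcongr
          exact exp_neg_mul_mul_exp_le t)).2.differentiableAt
  have e : invPhiFT bb η = fun z : ℂ => ∫ t : ℝ, (PhiS bb (t + (-η : ℝ) * Complex.I))⁻¹ *
      Complex.exp (-Complex.I * (-(2 * π) : ℝ) * z * (t + (-η : ℝ) * Complex.I)) := by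
    funext z
    rw [invPhiFT]
    congr 1
    funext t
    rw [invPhiKer, mul_comm]
    congr 2
    push_cast
    ring
  rw [e]
  exact h

theorem eq_zero_of_fourier_eq_zero {f : ℝ → ℂ} (hf : Continuous f) (hfi : Integrable f)
    (h : ∀ s : ℝ, ∫ x : ℝ, f x * Complex.exp (-2 * π * Complex.I * s * x) = 0) : f = 0 := by
  have hF : FourierTransform.fourier f = (0 : ℝ → ℂ) := by
    funext s
    rw [Real.fourier_real_eq_integral_exp_smul, Pi.zero_apply, ← h s]
    congr 1
    funext x
    rw [smul_eq_mul, mul_comm]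
    congr 2
    push_cast
    ring
  have := hf.fourierInv_fourier_eq hfi (by rw [hF]; exact integrable_zero _ _ _)
  rw [← this, hF]
  funext x
  rw [Real.fourierInv_eq']
  simp

theorem differentiableAt_dslope_of_strip {R : ℂ → ℂ} {y₁ y₂ : ℝ} {w₀ : ℂ} (h₁ : y₁ < w₀.im)
    (h₂ : w₀.im < y₂) (hR : ∀ w : ℂ, y₁ ≤ w.im → w.im ≤ y₂ → DifferentiableAt ℂ R w) {w : ℂ}
    (hw₁ : y₁ ≤ w.im) (hw₂ : w.im ≤ y₂) : DifferentiableAt ℂ (dslope R w₀) w := by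
  rcases eq_or_ne w w₀ with rfl | hne
  · have hopen : {z : ℂ | y₁ < z.im ∧ z.im < y₂} ∈ 𝓝 w :=
      ((isOpen_lt continuous_const Complex.continuous_im).inter
        (isOpen_lt Complex.continuous_im continuous_const)).mem_nhds ⟨h₁, h₂⟩
    refine ((Complex.differentiableOn_dslope hopen).mpr ?_).differentiableAt hopen
    exact fun z hz => (hR z hz.1.le hz.2.le).differentiableWithinAt
  · exact (differentiableAt_dslope_of_ne hne).mpr (hR w hw₁ hw₂)

/-- A Liouville theorem for periodic functions on a strip, at points of the imaginary axis. -/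
theorem eq_of_periodic_strip_of_re_eq_zero {R : ℂ → ℂ} {β y κ C v₀ : ℝ} (hβ : 0 < β)
    (hv₁ : y - β < v₀) (hv₂ : v₀ < y) (hκ : 0 ≤ κ) (hκβ : κ < π / β)
    (hR : ∀ w : ℂ, y - β ≤ w.im → w.im ≤ y → DifferentiableAt ℂ R w)
    (hper : ∀ x : ℝ, R (x + (y - β : ℝ) * Complex.I) = R (x + y * Complex.I))
    (hbd : ∀ x v : ℝ, y - β ≤ v → v ≤ y → ‖R (x + v * Complex.I)‖ ≤ C * Real.exp (κ * |x|))
    (x : ℝ) : R (x + y * Complex.I) = R (v₀ * Complex.I) := by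
  have hp : 0 < π / β := by positivity
  set w₀ : ℂ := v₀ * Complex.I with hw₀
  have hw₀im : w₀.im = v₀ := by simp [hw₀]
  set s : ℂ → ℂ := fun w => Complex.sinh ((w - w₀) * (π / β : ℝ)) with hs
  have hsd : Differentiable ℂ s := by
    intro w
    fun_prop
  have hs0 : s w₀ = 0 := by simp [hs]
  have hsne : ∀ w : ℂ, y - β ≤ w.im → w.im ≤ y → w ≠ w₀ → s w ≠ 0 := fun w h1 h2 hne => by
    refine sinh_ne_zero_of_abs_im_lt (mul_ne_zero (sub_ne_zero.mpr hne)
      (by exact_mod_cast hp.ne')) ?_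
    rw [Complex.im_mul_ofReal, abs_mul, abs_of_pos hp, Complex.sub_im, hw₀im]
    have : |w.im - v₀| < β := by
      rw [abs_lt]
      constructor <;> linarith
    calc _ < β * (π / β) := by gcongr
      _ = π := by field_simp
  have hne : ∀ w : ℂ, y - β ≤ w.im → w.im ≤ y → dslope s w₀ w ≠ 0 := fun w h1 h2 => by
    rcases eq_or_ne w w₀ with h | hw
    · rw [h, dslope_same]
      have : HasDerivAt s ((π / β : ℝ) : ℂ) w₀ := by
        refine (((hasDerivAt_id' w₀).sub_const w₀).mul_const ((π / β : ℝ) : ℂ)).csinh.congr_deriv ?_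
        simp
      rw [this.deriv]
      exact_mod_cast hp.ne'
    · rw [dslope_of_ne _ hw, slope_def_field, hs0, sub_zero]
      exact div_ne_zero (hsne w h1 h2 hw) (sub_ne_zero.mpr hw)
  set f : ℂ → ℂ := fun w => dslope R w₀ w / dslope s w₀ w with hf
  have hfd : ∀ w : ℂ, y - β ≤ w.im → w.im ≤ y → DifferentiableAt ℂ f w := fun w h1 h2 =>
    (differentiableAt_dslope_of_strip (by rw [hw₀im]; exact hv₁) (by rw [hw₀im]; exact hv₂)
      hR h1 h2).div (differentiableAt_dslope_of_strip (by rw [hw₀im]; exact hv₁)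
      (by rw [hw₀im]; exact hv₂) (fun z _ _ => hsd z) h1 h2) (hne w h1 h2)
  have hfe : ∀ w : ℂ, w ≠ w₀ → f w = (R w - R w₀) / s w := fun w hw => by
    have := sub_ne_zero.mpr hw
    simp only [hf]
    rw [dslope_of_ne _ hw, dslope_of_ne _ hw, slope_def_field, slope_def_field, hs0, sub_zero]
    field_simp
  have hC : ‖R w₀‖ ≤ C := by simpa using hbd 0 v₀ hv₁.le hv₂.le
  have hC0 : 0 ≤ C := (norm_nonneg _).trans hC
  have p1 := one_sub_exp_neg_pos hp
  have hfb : ∀ x v : ℝ, 1 ≤ |x| → y - β ≤ v → v ≤ y → ‖f (x + v * Complex.I)‖ ≤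
      2 * C * ((1 - Real.exp (-2 * (π / β))) / 2)⁻¹ * Real.exp (-(π / β - κ) * |x|) := by
    intro x v hx h1 h2
    have hxne : (x + v * Complex.I : ℂ) ≠ w₀ := by
      intro h
      have := congrArg Complex.re h
      simp [hw₀] at this
      rw [this] at hx
      norm_num at hx
    rw [hfe _ hxne, norm_div]
    have e1 : ‖R (x + v * Complex.I) - R w₀‖ ≤ 2 * C * Real.exp (κ * |x|) := by
      refine (norm_sub_le _ _).trans ?_
      have : 1 ≤ Real.exp (κ * |x|) := Real.one_le_exp (by positivity)
      have := hbd x v h1 h2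
      nlinarith
    have e2 := norm_sinh_mul_ge hp hx (v - v₀)
    have e3 : s (x + v * Complex.I) =
        Complex.sinh ((x + (v - v₀ : ℝ) * Complex.I) * (π / β : ℝ)) := by
      rw [hs, hw₀]
      push_cast
      ring_nf
    rw [← e3] at e2
    refine (div_le_div₀ (by positivity) e1 (by positivity) e2).trans (le_of_eq ?_)
    rw [show -(π / β - κ) * |x| = κ * |x| + -(π / β * |x|) by ring, Real.exp_add, Real.exp_neg]
    field_simp
  have hδ : 0 < π / β - κ := by linarith
  have hanti : ∀ x : ℝ, f (x + (y - β : ℝ) * Complex.I) = -f (x + y * Complex.I) := by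
    intro x
    have n1 : (x + (y - β : ℝ) * Complex.I : ℂ) ≠ w₀ := by
      intro h
      have := congrArg Complex.im h
      rw [hw₀im] at this
      simp at this
      linarith
    have n2 : (x + y * Complex.I : ℂ) ≠ w₀ := by
      intro h
      have := congrArg Complex.im h
      rw [hw₀im] at this
      simp at this
      linarith
    rw [hfe _ n1, hfe _ n2, hper, ← div_neg]
    congr 1
    simp only [hs]
    rw [← Complex.sinh_sub_pi_mul_I]
    congr 1
    have hβ' : (β : ℂ) ≠ 0 := by exact_mod_cast hβ.ne'
    push_cast
    field_simp
    ring
  have hcont : Continuous fun x : ℝ => f (x + y * Complex.I) :=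
    continuous_horizontal_line fun z hz =>
      (hfd z (by rw [hz]; linarith) (by rw [hz])).continuousAt
  have hzero : (fun x : ℝ => f (x + y * Complex.I)) = 0 := by
    refine eq_zero_of_fourier_eq_zero hcont (integrable_of_norm_le_exp hcont hδ
      fun x hx => hfb x y hx (by linarith) le_rfl) fun t => ?_
    have key := integral_horizontal_line_eq
      (f := fun w => f w * Complex.exp (-2 * π * Complex.I * t * w)) (v₁ := y - β) (v₂ := y)
      (by linarith) (fun z h1 h2 => by
        have := hfd z h1 h2
        fun_prop) hδ
      (C := 2 * C * ((1 - Real.exp (-2 * (π / β))) / 2)⁻¹ *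
        Real.exp (2 * π * |t| * (|y| + β))) (fun x v hx h1 h2 => by
        rw [norm_mul]
        have e1 : ‖Complex.exp (-2 * π * Complex.I * t * (x + v * Complex.I))‖ ≤
            Real.exp (2 * π * |t| * (|y| + β)) := by
          rw [Complex.norm_exp, Real.exp_le_exp]
          have a1 : t * v ≤ |t| * |v| := by
            rw [← abs_mul]
            exact le_abs_self _
          have a2 : |v| ≤ |y| + β := by
            rw [abs_le]
            constructor <;> linarith [neg_abs_le y, le_abs_self y]
          have a3 : |t| * |v| ≤ |t| * (|y| + β) := by gcongr
          have a4 : π * (t * v) ≤ π * (|t| * (|y| + β)) :=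
            mul_le_mul_of_nonneg_left (a1.trans a3) Real.pi_pos.le
          have : (-2 * π * Complex.I * t * (x + v * Complex.I) : ℂ).re = 2 * (π * (t * v)) := by
            simp
            ring
          rw [this]
          linarith
        refine (mul_le_mul (hfb x v hx h1 h2) e1 (norm_nonneg _) (by positivity)).trans
          (le_of_eq ?_)
        ring)
    set J := ∫ x : ℝ, f (x + y * Complex.I) * Complex.exp (-2 * π * Complex.I * t * x)
    have k1 : ∫ x : ℝ, f (x + y * Complex.I) *
        Complex.exp (-2 * π * Complex.I * t * (x + y * Complex.I)) =
        Real.exp (2 * π * t * y) * J := by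
      rw [← integral_const_mul]
      congr 1
      funext x
      rw [show (-2 * π * Complex.I * t * (x + y * Complex.I) : ℂ) =
        (2 * π * t * y : ℝ) + -2 * π * Complex.I * t * x by
          push_cast
          linear_combination (-2 * π * t * y) * Complex.I_sq, Complex.exp_add]
      push_cast
      ring
    have k2 : ∫ x : ℝ, f (x + (y - β : ℝ) * Complex.I) *
        Complex.exp (-2 * π * Complex.I * t * (x + (y - β : ℝ) * Complex.I)) =
        -Real.exp (2 * π * t * (y - β)) * J := by
      rw [← integral_const_mul]
      congr 1
      funext x
      rw [hanti, show (-2 * π * Complex.I * t * (x + (y - β : ℝ) * Complex.I) : ℂ) =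
        (2 * π * t * (y - β) : ℝ) + -2 * π * Complex.I * t * x by
          push_cast
          linear_combination (-2 * π * t * (y - β)) * Complex.I_sq, Complex.exp_add]
      push_cast
      ring
    simp only [k1, k2] at key
    have hpos : (Real.exp (2 * π * t * y) + Real.exp (2 * π * t * (y - β)) : ℂ) ≠ 0 := by
      have : Real.exp (2 * π * t * y) + Real.exp (2 * π * t * (y - β)) ≠ 0 := by positivity
      exact_mod_cast this
    refine (mul_eq_zero.mp (?_ : _ * J = 0)).resolve_left hpos
    linear_combination -key
  have hx := congrFun hzero x
  have n2 : (x + y * Complex.I : ℂ) ≠ w₀ := by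
    intro h
    have := congrArg Complex.im h
    rw [hw₀im] at this
    simp at this
    linarith
  simp only [Pi.zero_apply] at hx
  rw [hfe _ n2, div_eq_zero_iff] at hx
  have := hx.resolve_right (hsne _ (by simp [hβ.le]) (by simp) n2)
  exact sub_eq_zero.mp this

/-- A Liouville theorem for periodic functions of small exponential growth on a strip. -/
theorem eq_of_periodic_strip {R : ℂ → ℂ} {β y κ C : ℝ} (hβ : 0 < β)
    (hκ : 0 ≤ κ) (hκβ : κ < π / β)
    (hR : ∀ w : ℂ, y - β ≤ w.im → w.im ≤ y → DifferentiableAt ℂ R w)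
    (hper : ∀ x : ℝ, R (x + (y - β : ℝ) * Complex.I) = R (x + y * Complex.I))
    (hbd : ∀ x v : ℝ, y - β ≤ v → v ≤ y → ‖R (x + v * Complex.I)‖ ≤ C * Real.exp (κ * |x|))
    {w : ℂ} (hw₁ : y - β < w.im) (hw₂ : w.im < y) : R w = R (y * Complex.I) := by
  have hC : 0 ≤ C := by
    have := (norm_nonneg _).trans (hbd 0 y (by linarith) le_rfl)
    simpa using this
  have h := eq_of_periodic_strip_of_re_eq_zero (R := fun z => R (z + w.re)) (κ := κ)
    (C := C * Real.exp (κ * |w.re|)) hβ hw₁ hw₂ hκ hκβ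
    (fun z h1 h2 => by
      have := hR (z + w.re) (by simpa using h1) (by simpa using h2)
      exact this.comp z (by fun_prop))
    (fun x => by
      have := hper (x + w.re)
      push_cast at this ⊢
      convert this using 2 <;> ring)
    (fun x v h1 h2 => by
      have := hbd (x + w.re) v h1 h2
      have e : (x + v * Complex.I + w.re : ℂ) = ((x + w.re : ℝ) : ℂ) + v * Complex.I := by
        push_cast
        ring
      rw [e]
      refine this.trans ?_
      rw [mul_assoc, ← Real.exp_add, ← mul_add]
      gcongr
      rw [add_comm |w.re|]
      exact abs_add_le _ _)
    (-w.re)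
  rw [add_comm (w.im * Complex.I), Complex.re_add_im] at h
  rw [← h]
  congr 1
  push_cast
  ring

theorem invPhiFT_sub {bb : ℝ} (hbb : 0 < bb) {w : ℂ} (hw : w.im < 0) {η : ℝ}
    (hwη : bb - w.im < η) (hηQ : η < (bb + bb⁻¹) / 2) :
    invPhiFT bb η (w - Complex.I * bb) = Complex.exp (-Complex.I * π * bb ^ 2) *
      (Complex.exp (2 * π * bb * w) - 1) * invPhiFT bb η w := by
  have hbi : 0 < bb⁻¹ := inv_pos.mpr hbb
  have key : ∀ t : ℝ, invPhiKer bb (w - Complex.I * bb) (t + (-η : ℝ) * Complex.I) =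
      Complex.exp (-Complex.I * π * bb ^ 2) * (Complex.exp (2 * π * bb * w) *
        invPhiKer bb w (t + (-(η - bb) : ℝ) * Complex.I) -
        invPhiKer bb w (t + (-η : ℝ) * Complex.I)) := by
    intro t
    set u : ℂ := t + (-η : ℝ) * Complex.I with hu
    have huim : u.im = -η := by simp [hu]
    have hub : (t + (-(η - bb) : ℝ) * Complex.I : ℂ) = u + Complex.I * bb := by
      rw [hu]
      push_cast
      ring
    have hfun := PhiS_functional hbb (z := u + Complex.I * bb / 2) (by
      have : (u + Complex.I * bb / 2).im = -η + bb / 2 := by simp [huim]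
      rw [this, one_div, mul_inv, abs_lt]
      constructor <;> linarith)
    rw [add_sub_cancel_right, show u + Complex.I * bb / 2 + Complex.I * bb / 2 =
      u + Complex.I * bb by ring] at hfun
    have e1 : Complex.exp (2 * π * bb * (u + Complex.I * bb / 2)) =
        Complex.exp (2 * π * bb * u) * Complex.exp (Complex.I * π * bb ^ 2) := by
      rw [← Complex.exp_add]
      congr 1
      ring
    have e2 : Complex.exp (2 * π * Complex.I * (w - Complex.I * bb) * u) =
        Complex.exp (2 * π * Complex.I * w * u) * Complex.exp (2 * π * bb * u) := by
      rw [← Complex.exp_add]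
      congr 1
      linear_combination (-2 * π * bb * u) * Complex.I_sq
    have e3 : Complex.exp (2 * π * bb * w) * Complex.exp (2 * π * Complex.I * w *
        (u + Complex.I * bb)) = Complex.exp (2 * π * Complex.I * w * u) := by
      rw [← Complex.exp_add]
      congr 1
      linear_combination (2 * π * bb * w) * Complex.I_sq
    have e4 : Complex.exp (-Complex.I * π * bb ^ 2) * Complex.exp (Complex.I * π * bb ^ 2) = 1 := by
      rw [← Complex.exp_add, ← Complex.exp_zero]
      congr 1
      ring
    have n1 := PhiS_ne_zero bb u
    have n2 := PhiS_ne_zero bb (u + Complex.I * bb)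
    rw [hub, invPhiKer, invPhiKer, invPhiKer, ← mul_assoc (Complex.exp (2 * π * bb * w)), e3, e2]
    rw [e1] at hfun
    have hinv : (PhiS bb (u + Complex.I * bb))⁻¹ =
        (1 + Complex.exp (2 * π * bb * u) * Complex.exp (Complex.I * π * bb ^ 2)) *
          (PhiS bb u)⁻¹ := by
      rw [eq_mul_inv_iff_mul_eq₀ n1, hfun]
      field_simp
    rw [hinv]
    linear_combination (-Complex.exp (2 * π * Complex.I * w * u) * Complex.exp (2 * π * bb * u) *
      (PhiS bb u)⁻¹) * e4
  have i1 : Integrable fun t : ℝ => invPhiKer bb w (t + (-(η - bb) : ℝ) * Complex.I) :=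
    integrable_invPhiKer hbb hw (by linarith) (by linarith)
  have i2 : Integrable fun t : ℝ => invPhiKer bb w (t + (-η : ℝ) * Complex.I) :=
    integrable_invPhiKer hbb hw (by linarith) hηQ
  rw [invPhiFT]
  simp_rw [key]
  rw [integral_const_mul, integral_sub (i1.const_mul _) i2, integral_const_mul]
  have e : ∫ t : ℝ, invPhiKer bb w (t + (-(η - bb) : ℝ) * Complex.I) = invPhiFT bb η w :=
    invPhiFT_eq hbb hw (by linarith) (by linarith) (by linarith) hηQ
  rw [e]
  rw [show ∫ t : ℝ, invPhiKer bb w (t + (-η : ℝ) * Complex.I) = invPhiFT bb η w from rfl]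
  ring

/-- The quotient of the Fourier transform of `1 / Φ_𝖻` by `e^{π(𝖻 + 𝖻⁻¹)w} Φ_𝖻(w + c_𝖻)`. -/
def ratioFn (bb : ℝ) (w : ℂ) : ℂ :=
  invPhiFT bb (((bb + bb⁻¹) / 2 - w.im) / 2) w * Complex.exp (-π * (bb + bb⁻¹) * w) *
    (PhiS bb (w + cB bb))⁻¹

theorem cB_eq (bb : ℝ) : cB bb = ((bb + bb⁻¹) / 2 : ℝ) * Complex.I := by
  rw [cB]
  push_cast
  ring

theorem cB_im (bb : ℝ) : (cB bb).im = (bb + bb⁻¹) / 2 := by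
  rw [cB_eq, Complex.im_ofReal_mul, Complex.I_im, mul_one]

theorem cB_re (bb : ℝ) : (cB bb).re = 0 := by
  rw [cB_eq, Complex.re_ofReal_mul, Complex.I_re, mul_zero]

theorem PhiS_sub_add_cB {bb : ℝ} (hbb : 0 < bb) {w : ℂ} (hw : w.im < 0) (hwb : -bb⁻¹ < w.im) :
    PhiS bb (w - Complex.I * bb + cB bb) =
      (1 - Complex.exp (2 * π * bb * w)) * PhiS bb (w + cB bb) := by
  have hb : (bb : ℂ) ≠ 0 := by exact_mod_cast hbb.ne'
  have hfun := PhiS_functional hbb (z := w + cB bb - Complex.I * bb / 2) (by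
    have : (w + cB bb - Complex.I * bb / 2).im = w.im + bb⁻¹ / 2 := by
      rw [Complex.sub_im, Complex.add_im, cB_im]
      simp
      ring
    rw [this, one_div, mul_inv, abs_lt]
    constructor <;> linarith)
  rw [sub_add_cancel, show w + cB bb - Complex.I * bb / 2 - Complex.I * bb / 2 =
    w - Complex.I * bb + cB bb by ring] at hfun
  have e1 : Complex.exp (2 * π * bb * (w + cB bb - Complex.I * bb / 2)) =
      -Complex.exp (2 * π * bb * w) := by
    rw [← neg_one_mul, ← Complex.exp_pi_mul_I, ← Complex.exp_add]
    congr 1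
    rw [cB]
    push_cast
    field_simp
    ring
  rw [hfun, e1, ← sub_eq_add_neg]

theorem ratioFn_eq {bb : ℝ} (hbb : 0 < bb) {w : ℂ} (hw : w.im < 0) {η : ℝ}
    (hwη : -w.im < η) (hηQ : η < (bb + bb⁻¹) / 2) :
    ratioFn bb w = invPhiFT bb η w * Complex.exp (-π * (bb + bb⁻¹) * w) *
      (PhiS bb (w + cB bb))⁻¹ := by
  rw [ratioFn, invPhiFT_eq hbb hw (by linarith) (by linarith) hwη hηQ]

theorem differentiableAt_ratioFn {bb : ℝ} (hbb : 0 < bb) {w : ℂ} (hw : w.im < 0)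
    (hwQ : -((bb + bb⁻¹) / 2) < w.im) : DifferentiableAt ℂ (ratioFn bb) w := by
  set η := ((bb + bb⁻¹) / 2 - w.im) / 2 with hη
  have h1 : -w.im < η := by linarith
  have h2 : η < (bb + bb⁻¹) / 2 := by linarith
  have hopen : {z : ℂ | z.im < 0 ∧ -η < z.im} ∈ 𝓝 w :=
    ((isOpen_lt Complex.continuous_im continuous_const).inter
      (isOpen_lt continuous_const Complex.continuous_im)).mem_nhds ⟨hw, neg_lt.mp h1⟩
  have d1 := differentiableAt_invPhiFT hbb hw h1 h2
  have d2 : DifferentiableAt ℂ (fun z => PhiS bb (z + cB bb)) w := by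
    have d : DifferentiableAt ℂ (PhiS bb) (w + cB bb) := differentiableAt_PhiS hbb (by
      rw [Complex.add_im, cB_im, abs_lt]
      constructor <;> linarith)
    exact DifferentiableAt.comp (g := PhiS bb) w d (by fun_prop)
  have n := PhiS_ne_zero bb (w + cB bb)
  have : DifferentiableAt ℂ (fun z => invPhiFT bb η z * Complex.exp (-π * (bb + bb⁻¹) * z) *
      (PhiS bb (z + cB bb))⁻¹) w := by
    exact (d1.mul (by fun_prop)).mul (d2.inv n)
  refine this.congr_of_eventuallyEq ?_
  filter_upwards [hopen] with z hz
  exact ratioFn_eq hbb hz.1 (by linarith [hz.2]) h2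

theorem ratioFn_periodic {bb : ℝ} (hbb : 0 < bb) {w : ℂ} (hw : w.im < 0)
    (hwQ : bb - (bb + bb⁻¹) / 2 < w.im) :
    ratioFn bb (w - Complex.I * bb) = ratioFn bb w := by
  have hbi : 0 < bb⁻¹ := inv_pos.mpr hbb
  have hb : (bb : ℂ) ≠ 0 := by exact_mod_cast hbb.ne'
  obtain ⟨η, hη1, hη2⟩ := exists_between (show bb - w.im < (bb + bb⁻¹) / 2 by linarith)
  have him : (w - Complex.I * bb).im = w.im - bb := by simp
  rw [ratioFn_eq hbb (w := w - Complex.I * bb) (by rw [him]; linarith) (η := η)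
    (by rw [him]; linarith) hη2, ratioFn_eq hbb hw (η := η) (by linarith) hη2,
    invPhiFT_sub hbb hw hη1 hη2]
  have hfun := PhiS_sub_add_cB hbb hw (by linarith)
  have e2 : Complex.exp (-π * (bb + bb⁻¹) * (w - Complex.I * bb)) =
      -Complex.exp (Complex.I * π * bb ^ 2) * Complex.exp (-π * (bb + bb⁻¹) * w) := by
    rw [neg_mul (Complex.exp _), ← Complex.exp_add, ← neg_one_mul (Complex.exp _),
      ← Complex.exp_pi_mul_I, ← Complex.exp_add]
    congr 1
    push_cast
    field_simp
    ring
  have e4 : Complex.exp (-Complex.I * π * bb ^ 2) * Complex.exp (Complex.I * π * bb ^ 2) = 1 := by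
    rw [← Complex.exp_add, ← Complex.exp_zero]
    congr 1
    ring
  have n1 := PhiS_ne_zero bb (w - Complex.I * bb + cB bb)
  have n2 := PhiS_ne_zero bb (w + cB bb)
  have hinv : (1 - Complex.exp (2 * π * bb * w)) * (PhiS bb (w - Complex.I * bb + cB bb))⁻¹ =
      (PhiS bb (w + cB bb))⁻¹ := by
    rw [mul_inv_eq_iff_eq_mul₀ n1, hfun]
    field_simp
  rw [e2, ← hinv]
  linear_combination ((1 - Complex.exp (2 * π * bb * w)) *
    (PhiS bb (w - Complex.I * bb + cB bb))⁻¹ * invPhiFT bb η w *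
    Complex.exp (-π * (bb + bb⁻¹) * w)) * e4

theorem stripBound_mono {bb : ℝ} (hbb : 0 < bb) {Y₁ Y₂ : ℝ} (h : Y₁ ≤ Y₂)
    (hY : Y₂ < (bb + bb⁻¹) / 2) : stripBound bb Y₁ ≤ stripBound bb Y₂ := by
  have hk := kerBound_pos hbb
  have : 0 < bb + bb⁻¹ - 2 * Y₂ := by linarith
  unfold stripBound
  gcongr

theorem norm_ratioFn_le_of_height {bb : ℝ} (hbb : 0 < bb) {x v η Y Y' m : ℝ} (hv : v < 0)
    (hηY : η ≤ Y) (hY : Y < (bb + bb⁻¹) / 2) (hm : 0 < m) (hmv : m ≤ -v) (hmη : m ≤ η + v)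
    (hvY : v + (bb + bb⁻¹) / 2 ≤ Y')
    (hY' : Y' < (bb + bb⁻¹) / 2) :
    ‖ratioFn bb (x + v * Complex.I)‖ ≤ stripBound bb Y * stripBound bb Y' * (2 / (2 * π * m)) *
      Real.exp (2 * π * η * x - π * (bb + bb⁻¹) * x +
        2 * π * (v + (bb + bb⁻¹) / 2) * max x 0) := by
  set w : ℂ := x + v * Complex.I with hw
  have him : w.im = v := by simp [hw]
  have hre : w.re = x := by simp [hw]
  have hp := Real.pi_pos
  have hs := stripBound_pos bb Y
  have hs' := stripBound_pos bb Y'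
  have h1 := norm_invPhiFT_le hbb (w := w) (η := η) (by linarith) (by linarith) (by linarith)
  rw [him, hre] at h1
  have h1' : ‖invPhiFT bb η w‖ ≤ stripBound bb Y * Real.exp (2 * π * η * x) *
      (2 / (2 * π * m)) := by
    refine h1.trans ?_
    have hmm : m ≤ min (-v) (η + v) := le_min hmv hmη
    have : 0 < min (-v) (η + v) := hm.trans_le hmm
    gcongr
    exact stripBound_mono hbb hηY hY
  have h2 := norm_PhiS_inv_le hbb (z := w + cB bb) (Y := Y') (by
    rw [Complex.add_im, cB_im, him, abs_of_pos (by linarith)]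
    exact hvY) hY'
  rw [Complex.add_im, cB_im, him, Complex.add_re, cB_re, hre, add_zero] at h2
  have h3 : ‖Complex.exp (-π * (bb + bb⁻¹ : ℝ) * w)‖ = Real.exp (-(π * (bb + bb⁻¹) * x)) := by
    rw [Complex.norm_exp, ← hre, ← Complex.ofReal_neg, ← Complex.ofReal_mul,
      Complex.re_ofReal_mul]
    congr 1
    ring
  rw [Complex.ofReal_add] at h3
  rw [ratioFn_eq hbb (η := η) (by linarith) (by linarith) (by linarith), norm_mul, norm_mul, h3]
  refine (mul_le_mul (mul_le_mul_of_nonneg_right h1' (Real.exp_nonneg _)) h2 (norm_nonneg _)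
    (by positivity)).trans (le_of_eq ?_)
  rw [Real.exp_add, sub_eq_add_neg, Real.exp_add]
  ring

theorem exists_norm_ratioFn_le {bb : ℝ} (hbb : 0 < bb) {y₁ y₂ : ℝ}
    (hy₁ : -((bb + bb⁻¹) / 2) < y₁) (hy₂ : y₂ < 0) : ∃ C : ℝ, ∀ x v : ℝ, y₁ ≤ v → v ≤ y₂ →
      ‖ratioFn bb (x + v * Complex.I)‖ ≤ C * Real.exp (π * ((bb + bb⁻¹) / 2 + y₁) * |x|) := by
  set σ := ((bb + bb⁻¹) / 2 + y₁) / 2 with hσ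
  have hσ0 : 0 < σ := by linarith
  have hm : 0 < min (-y₂) σ := lt_min (by linarith) hσ0
  refine ⟨stripBound bb ((bb + bb⁻¹) / 2 - σ) * stripBound bb (y₂ + (bb + bb⁻¹) / 2) *
    (2 / (2 * π * min (-y₂) σ)), fun x v h1 h2 => ?_⟩
  have hm1 : min (-y₂) σ ≤ -v := (min_le_left _ _).trans (by linarith)
  have hm2 : min (-y₂) σ ≤ σ := min_le_right _ _
  rcases le_total x 0 with hx | hx
  · refine (norm_ratioFn_le_of_height hbb (x := x) (v := v) (η := (bb + bb⁻¹) / 2 - σ)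
      (by linarith) le_rfl (by linarith) hm hm1 (by linarith)
      (Y' := y₂ + (bb + bb⁻¹) / 2) (by linarith) (by linarith)).trans (le_of_eq ?_)
    congr 2
    rw [max_eq_right hx, abs_of_nonpos hx, hσ]
    ring
  · refine (norm_ratioFn_le_of_height hbb (x := x) (v := v) (η := -v + σ)
      (Y := (bb + bb⁻¹) / 2 - σ)
      (by linarith) (by linarith) (by linarith) hm hm1 (by linarith)
      (Y' := y₂ + (bb + bb⁻¹) / 2) (by linarith) (by linarith)).trans (le_of_eq ?_)
    congr 2
    rw [max_eq_left hx, abs_of_nonneg hx, hσ]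
    ring

theorem ratioFn_const {bb : ℝ} (hbb : 0 < bb) (hb1 : bb < 1) :
    ∃ R : ℂ, ∀ w : ℂ, w.im < 0 → -((bb + bb⁻¹) / 2) < w.im → ratioFn bb w = R := by
  have hbi : 1 < bb⁻¹ := (one_lt_inv₀ hbb).mpr hb1
  obtain ⟨y, hy1, hy2⟩ := exists_between (show bb - (bb + bb⁻¹) / 2 < 0 by linarith)
  obtain ⟨C, hC⟩ := exists_norm_ratioFn_le hbb (y₁ := y - bb) (y₂ := y) (by linarith) hy2
  have hp := Real.pi_pos
  have hloc : ∀ w : ℂ, y - bb < w.im → w.im < y → ratioFn bb w = ratioFn bb (y * Complex.I) := by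
    intro w h1 h2
    refine eq_of_periodic_strip hbb (κ := π * ((bb + bb⁻¹) / 2 + (y - bb))) (C := C)
      (mul_nonneg hp.le (by linarith)) ?_
      (fun z hz1 hz2 => differentiableAt_ratioFn hbb (by linarith) (by linarith))
      (fun x => ?_) hC h1 h2
    · rw [div_eq_mul_inv]
      exact mul_lt_mul_of_pos_left (by linarith) hp
    · have := ratioFn_periodic hbb (w := x + y * Complex.I) (by simpa using hy2)
        (by simpa using hy1)
      rw [← this]
      congr 1
      push_cast
      ring
  have hSopen : IsOpen {w : ℂ | w.im < 0 ∧ -((bb + bb⁻¹) / 2) < w.im} :=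
    (isOpen_lt Complex.continuous_im continuous_const).inter
      (isOpen_lt continuous_const Complex.continuous_im)
  have hSconv : Convex ℝ {w : ℂ | w.im < 0 ∧ -((bb + bb⁻¹) / 2) < w.im} :=
    (convex_halfSpace_im_lt 0).inter (convex_halfSpace_im_gt _)
  have hd : DifferentiableOn ℂ (ratioFn bb) {w : ℂ | w.im < 0 ∧ -((bb + bb⁻¹) / 2) < w.im} :=
    fun w hw => (differentiableAt_ratioFn hbb hw.1 hw.2).differentiableWithinAt
  have hz0 : (((y - bb / 2 : ℝ) : ℂ) * Complex.I).im = y - bb / 2 := by simp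
  have heq := (hd.analyticOnNhd hSopen).eqOn_of_preconnected_of_eventuallyEq
    (g := fun _ => ratioFn bb (y * Complex.I)) analyticOnNhd_const hSconv.isPreconnected
    (z₀ := ((y - bb / 2 : ℝ) : ℂ) * Complex.I) ⟨by rw [hz0]; linarith, by rw [hz0]; linarith⟩ (by
      have : {w : ℂ | y - bb < w.im ∧ w.im < y} ∈ 𝓝 (((y - bb / 2 : ℝ) : ℂ) * Complex.I) :=
        ((isOpen_lt continuous_const Complex.continuous_im).inter
          (isOpen_lt Complex.continuous_im continuous_const)).mem_nhds
          ⟨show y - bb < _ by rw [hz0]; linarith, show _ < y by rw [hz0]; linarith⟩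
      filter_upwards [this] with w hw
      exact hloc w hw.1 hw.2)
  exact ⟨_, fun w h1 h2 => heq ⟨h1, h2⟩⟩

theorem conj_phiKer (bb : ℝ) (z w : ℂ) : starRingEnd ℂ (phiKer bb z w) =
    -phiKer bb (starRingEnd ℂ z) (-starRingEnd ℂ w) := by
  simp only [phiKer, map_div₀, map_mul, ← Complex.exp_conj, ← Complex.sinh_conj, map_neg,
    Complex.conj_I, Complex.conj_ofReal, map_ofNat, neg_mul, neg_div, Complex.sinh_neg]
  rw [← div_neg]
  congr 1
  · congr 1
    ring
  · ring

theorem conj_logPhi (bb : ℝ) (z : ℂ) :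
    starRingEnd ℂ (logPhi bb z) = -logPhi bb (starRingEnd ℂ z) := by
  rw [logPhi, ← integral_conj, logPhi, ← integral_neg_eq_self, ← integral_neg]
  congr 1
  funext t
  rw [conj_phiKer]
  congr 2
  simp
  ring

theorem cB_inv (bb : ℝ) : cB bb⁻¹ = cB bb := by
  simp only [cB, inv_inv, Complex.ofReal_inv]
  ring

theorem PhiS_sub_inv_add_cB {bb : ℝ} (hbb : 0 < bb) {w : ℂ} (hw : w.im < 0) (hwb : -bb < w.im) :
    PhiS bb (w - Complex.I * (bb⁻¹ : ℝ) + cB bb) =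
      (1 - Complex.exp (2 * π * (bb⁻¹ : ℝ) * w)) * PhiS bb (w + cB bb) := by
  have := PhiS_sub_add_cB (inv_pos.mpr hbb) hw (by rwa [inv_inv])
  rwa [PhiS_inv_param, PhiS_inv_param, cB_inv] at this

theorem tendsto_one_sub_exp_div (k : ℝ) :
    Tendsto (fun y : ℝ => (1 - Complex.exp (2 * π * k * (-(y : ℂ) * Complex.I))) / y) (𝓝[>] 0)
      (𝓝 (2 * π * k * Complex.I)) := by
  have h : HasDerivAt (fun y : ℝ => 1 - Complex.exp (2 * π * k * (-(y : ℂ) * Complex.I)))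
      (2 * π * k * Complex.I) 0 := by
    have h1 : HasDerivAt (fun y : ℝ => 2 * π * k * (-(y : ℂ) * Complex.I))
        (2 * π * k * (-1 * Complex.I)) 0 :=
      (((Complex.ofRealCLM.hasDerivAt (x := 0)).neg.mul_const _).const_mul _)
    have h2 := (h1.cexp).const_sub 1
    refine h2.congr_deriv ?_
    simp
  have := h.tendsto_slope_zero_right
  refine this.congr fun y => ?_
  simp [div_eq_inv_mul]

theorem continuousAt_PhiS_vertical {bb : ℝ} (hbb : 0 < bb) {z : ℂ}
    (hz : |z.im| < (bb + bb⁻¹) / 2) :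
    Tendsto (fun y : ℝ => PhiS bb (-(y : ℂ) * Complex.I + z)) (𝓝[>] 0) (𝓝 (PhiS bb z)) := by
  have h1 : Tendsto (fun y : ℝ => -(y : ℂ) * Complex.I + z) (𝓝[>] 0) (𝓝 z) := by
    have : Continuous fun y : ℝ => -(y : ℂ) * Complex.I + z := by fun_prop
    have := this.tendsto 0
    simp only [Complex.ofReal_zero, neg_zero, zero_mul, zero_add] at this
    exact this.mono_left nhdsWithin_le_nhds
  exact (differentiableAt_PhiS hbb hz).continuousAt.tendsto.comp h1

theorem abs_sub_inv_div_two_lt {bb : ℝ} (hbb : 0 < bb) :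
    |(bb⁻¹ - bb) / 2| < (bb + bb⁻¹) / 2 := by
  have := inv_pos.mpr hbb
  rw [abs_lt]
  constructor <;> linarith

theorem PhiS_eq_sq_mul_PhiS_neg {bb : ℝ} (hbb : 0 < bb) :
    PhiS bb (((bb⁻¹ - bb) / 2 : ℝ) * Complex.I) =
      bb ^ 2 * PhiS bb (-(((bb⁻¹ - bb) / 2 : ℝ) * Complex.I)) := by
  have hbi := inv_pos.mpr hbb
  have hb : (bb : ℂ) ≠ 0 := by exact_mod_cast hbb.ne'
  have hp : (π : ℂ) ≠ 0 := by exact_mod_cast Real.pi_ne_zero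
  set z : ℂ := ((bb⁻¹ - bb) / 2 : ℝ) * Complex.I with hz
  have hzim : |z.im| < (bb + bb⁻¹) / 2 := by
    simpa [hz] using abs_sub_inv_div_two_lt hbb
  have t1 := (continuousAt_PhiS_vertical hbb hzim).mul (tendsto_one_sub_exp_div bb⁻¹)
  have t2 := (continuousAt_PhiS_vertical hbb (z := -z) (by simpa using hzim)).mul
    (tendsto_one_sub_exp_div bb)
  have heq : (fun y : ℝ => PhiS bb (-(y : ℂ) * Complex.I + z) *
      ((1 - Complex.exp (2 * π * (bb⁻¹ : ℝ) * (-(y : ℂ) * Complex.I))) / y)) =ᶠ[𝓝[>] 0]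
      fun y : ℝ => PhiS bb (-(y : ℂ) * Complex.I + -z) *
      ((1 - Complex.exp (2 * π * bb * (-(y : ℂ) * Complex.I))) / y) := by
    filter_upwards [self_mem_nhdsWithin, nhdsWithin_le_nhds (eventually_lt_nhds hbb),
      nhdsWithin_le_nhds (eventually_lt_nhds hbi)] with y hy h1 h2
    rw [mem_Ioi] at hy
    have him : (-(y : ℂ) * Complex.I).im = -y := by simp
    have f1 := PhiS_sub_add_cB hbb (w := -(y : ℂ) * Complex.I) (by rw [him]; linarith)
      (by rw [him]; linarith)
    have f2 := PhiS_sub_inv_add_cB hbb (w := -(y : ℂ) * Complex.I) (by rw [him]; linarith)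
      (by rw [him]; linarith)
    have e1 : -(y : ℂ) * Complex.I - Complex.I * bb + cB bb = -(y : ℂ) * Complex.I + z := by
      rw [hz, cB]
      push_cast
      ring
    have e2 : -(y : ℂ) * Complex.I - Complex.I * (bb⁻¹ : ℝ) + cB bb =
        -(y : ℂ) * Complex.I + -z := by
      rw [hz, cB]
      push_cast
      ring
    rw [e1] at f1
    rw [e2] at f2
    rw [f1, f2]
    ring
  have hlim := tendsto_nhds_unique (t1.congr' heq) t2
  rw [Complex.ofReal_inv] at hlim
  have hI := Complex.I_ne_zero
  field_simp at hlim
  linear_combination hlim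

theorem PhiS_sub_inv_eq {bb : ℝ} (hbb : 0 < bb) :
    PhiS bb (((bb⁻¹ - bb) / 2 : ℝ) * Complex.I) =
      bb * Complex.exp (Complex.I * π * (1 / 4 - (bb ^ 2 + (bb⁻¹) ^ 2) / 12)) := by
  have hb : (bb : ℂ) ≠ 0 := by exact_mod_cast hbb.ne'
  have h1 := PhiS_eq_sq_mul_PhiS_neg hbb
  have hz2 : (((bb⁻¹ - bb) / 2 : ℝ) * Complex.I : ℂ) ^ 2 =
      -((bb ^ 2 + (bb⁻¹) ^ 2) - 2) / 4 := by
    rw [mul_pow, Complex.I_sq]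
    push_cast
    field_simp
    ring
  set z : ℂ := ((bb⁻¹ - bb) / 2 : ℝ) * Complex.I with hz
  have hzim : |z.im| < (bb + bb⁻¹) / 2 := by
    simpa [hz] using abs_sub_inv_div_two_lt hbb
  have hsum := logPhi_add_logPhi_neg hbb hzim
  have hconj : starRingEnd ℂ (logPhi bb z) = -logPhi bb (-z) := by
    rw [conj_logPhi]
    rw [hz, map_mul, Complex.conj_ofReal, Complex.conj_I, mul_neg]
  have hdiff : logPhi bb z - logPhi bb (-z) = ((2 * (logPhi bb z).re : ℝ) : ℂ) := by
    rw [← Complex.add_conj, hconj, sub_eq_add_neg]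
  rw [PhiS_eq_exp_logPhi, PhiS_eq_exp_logPhi, ← sub_eq_zero] at h1
  have hexp : Complex.exp ((2 * (logPhi bb z).re : ℝ) : ℂ) = ((bb ^ 2 : ℝ) : ℂ) := by
    rw [← hdiff, Complex.exp_sub, div_eq_iff (Complex.exp_ne_zero _)]
    push_cast
    linear_combination h1
  have hre : Real.exp ((logPhi bb z).re) = bb := by
    have h2 : Real.exp (2 * (logPhi bb z).re) = bb ^ 2 := by exact_mod_cast hexp
    rw [two_mul, Real.exp_add, ← pow_two] at h2
    exact (pow_left_inj₀ (Real.exp_nonneg _) hbb.le two_ne_zero).mp h2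
  have hlog : logPhi bb z = ((logPhi bb z).re : ℂ) +
      Complex.I * π * (1 / 4 - (bb ^ 2 + (bb⁻¹) ^ 2) / 12) := by
    rw [hz2] at hsum
    push_cast at hsum hdiff ⊢
    linear_combination (hsum + hdiff) / 2
  rw [PhiS_eq_exp_logPhi, hlog, Complex.exp_add, ← Complex.ofReal_exp, hre]

theorem tendsto_PhiS_inv_atBot {bb : ℝ} (hbb : 0 < bb) {v : ℝ} (hv : |v| < (bb + bb⁻¹) / 2) :
    Tendsto (fun t : ℝ => (PhiS bb (t + v * Complex.I))⁻¹) atBot (𝓝 1) := by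
  have h1 : Tendsto (fun t : ℝ => logPhi bb (t + v * Complex.I)) atBot (𝓝 0) := by
    refine squeeze_zero_norm (a := fun t : ℝ => kerBound bb * (2 / (bb + bb⁻¹ - 2 * |v|)) *
      Real.exp (2 * contourHeight bb * t)) (fun t => ?_) ?_
    · simpa using norm_logPhi_le hbb (z := t + v * Complex.I) (by simpa using hv)
    · have : Tendsto (fun t : ℝ => Real.exp (2 * contourHeight bb * t)) atBot (𝓝 0) :=
        Real.tendsto_exp_atBot.comp
          (tendsto_id.const_mul_atBot (by linarith [contourHeight_pos hbb]))
      simpa using this.const_mul (kerBound bb * (2 / (bb + bb⁻¹ - 2 * |v|)))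
  have h2 := (Complex.continuous_exp.tendsto 0).comp h1
  rw [Complex.exp_zero] at h2
  have h3 := h2.inv₀ one_ne_zero
  rw [inv_one] at h3
  exact h3.congr fun t => by rw [PhiS_eq_exp_logPhi, Function.comp_apply]

/-- An Abelian theorem for the two-sided Laplace transform. -/
theorem tendsto_mul_laplace {G : ℝ → ℂ} (hG : Continuous G) {B η : ℝ} (hη : 0 < η)
    (hbd : ∀ t, ‖G t‖ ≤ B * Real.exp (2 * π * -η * max t 0)) (hlim : Tendsto G atBot (𝓝 1)) :
    Tendsto (fun y : ℝ => (y : ℂ) * ∫ t : ℝ, Complex.exp (2 * π * y * t) * G t) (𝓝[>] 0)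
      (𝓝 (1 / (2 * π))) := by
  have hp := Real.pi_pos
  have hB : 0 ≤ B := by
    have := (norm_nonneg _).trans (hbd 0)
    simpa using this
  have hsub : ∀ᶠ y : ℝ in 𝓝[>] 0, ∫ t : ℝ, Complex.exp (2 * π * t) * G (t / y) =
      (y : ℂ) * ∫ t : ℝ, Complex.exp (2 * π * y * t) * G t := by
    filter_upwards [self_mem_nhdsWithin] with y hy
    rw [mem_Ioi] at hy
    have hy' : (y : ℂ) ≠ 0 := by exact_mod_cast hy.ne'
    have := Measure.integral_comp_div (fun t : ℝ => Complex.exp (2 * π * y * t) * G t) y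
    rw [abs_of_pos hy, Complex.real_smul] at this
    rw [← this]
    congr 1
    funext t
    congr 2
    push_cast
    field_simp
  have hval : ∫ t : ℝ, (Iio (0 : ℝ)).indicator (fun t : ℝ => Complex.exp (2 * π * t)) t =
      1 / (2 * π) := by
    rw [integral_indicator measurableSet_Iio, ← integral_Iic_eq_integral_Iio]
    have := integral_exp_mul_complex_Iic (a := 2 * π) (by simpa using hp) 0
    simpa using this
  rw [← hval]
  refine Tendsto.congr' hsub ?_
  refine tendsto_integral_filter_of_dominated_convergence
    (fun t => B * Real.exp (-(2 * π) * |t|)) ?_ ?_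
    ((integrable_exp_neg_mul_abs (by linarith)).const_mul _) ?_
  · refine Eventually.of_forall fun y => ?_
    have : Continuous fun t : ℝ => Complex.exp (2 * π * t) * G (t / y) := by fun_prop
    exact this.aestronglyMeasurable
  · filter_upwards [self_mem_nhdsWithin, nhdsWithin_le_nhds
      (eventually_lt_nhds (show (0 : ℝ) < η / 2 by linarith))] with y hy hyη
    rw [mem_Ioi] at hy
    refine Eventually.of_forall fun t => ?_
    rw [norm_mul, Complex.norm_exp]
    have e : (2 * π * t : ℂ).re = 2 * π * t := by
      rw [← Complex.ofReal_ofNat, ← Complex.ofReal_mul, ← Complex.ofReal_mul, Complex.ofReal_re]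
    rw [e]
    refine (mul_le_mul_of_nonneg_left (hbd _) (Real.exp_nonneg _)).trans ?_
    rw [mul_left_comm, ← Real.exp_add]
    refine mul_le_mul_of_nonneg_left ?_ hB
    rw [Real.exp_le_exp]
    rcases le_total t 0 with h | h
    · rw [max_eq_right (div_nonpos_of_nonpos_of_nonneg h hy.le), abs_of_nonpos h]
      linarith
    · rw [max_eq_left (div_nonneg h hy.le), abs_of_nonneg h]
      have : 2 * t ≤ η * (t / y) := by
        rw [mul_div_assoc', le_div_iff₀ hy]
        nlinarith
      nlinarith
  · have hne : ∀ᵐ t : ℝ, t ≠ 0 := by simp [ae_iff]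
    filter_upwards [hne] with t ht
    rcases lt_or_gt_of_ne ht with h | h
    · rw [indicator_of_mem (show t ∈ Iio (0 : ℝ) from h)]
      have : Tendsto (fun y : ℝ => t / y) (𝓝[>] 0) atBot := by
        simp only [div_eq_mul_inv]
        exact tendsto_inv_nhdsGT_zero.const_mul_atTop_of_neg h
      simpa using (hlim.comp this).const_mul (Complex.exp (2 * π * t))
    · rw [indicator_of_notMem (show t ∉ Iio (0 : ℝ) from not_lt.mpr h.le)]
      have h1 : Tendsto (fun y : ℝ => t / y) (𝓝[>] 0) atTop := by
        simp only [div_eq_mul_inv]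
        exact tendsto_inv_nhdsGT_zero.const_mul_atTop h
      have h2 : Tendsto G atTop (𝓝 0) := by
        refine squeeze_zero_norm' (a := fun t => B * Real.exp (2 * π * -η * t)) ?_ ?_
        · filter_upwards [eventually_ge_atTop 0] with s hs
          simpa [max_eq_left hs] using hbd s
        · have : Tendsto (fun t : ℝ => Real.exp (2 * π * -η * t)) atTop (𝓝 0) :=
            Real.tendsto_exp_atBot.comp (tendsto_id.const_mul_atTop_of_neg (by nlinarith))
          simpa using this.const_mul B
      simpa using (h2.comp h1).const_mul (Complex.exp (2 * π * t))

theorem tendsto_mul_invPhiFT {bb : ℝ} (hbb : 0 < bb) {η : ℝ} (hη : 0 < η)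
    (hηQ : η < (bb + bb⁻¹) / 2) :
    Tendsto (fun y : ℝ => (y : ℂ) * invPhiFT bb η (-(y : ℂ) * Complex.I)) (𝓝[>] 0)
      (𝓝 (1 / (2 * π))) := by
  have hG : Continuous fun t : ℝ => (PhiS bb (t + (-η : ℝ) * Complex.I))⁻¹ := by
    simpa [invPhiKer] using continuous_invPhiKer hbb 0 hη hηQ
  have h1 := tendsto_mul_laplace hG hη (B := stripBound bb η) (fun t => by
      simpa using norm_PhiS_inv_le hbb (z := t + (-η : ℝ) * Complex.I) (Y := η)
        (by simp [abs_of_pos hη]) hηQ)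
    (tendsto_PhiS_inv_atBot hbb (by rwa [abs_neg, abs_of_pos hη]))
  have h2 : Tendsto (fun y : ℝ => Complex.exp (-(2 * π * Complex.I * y * η))) (𝓝[>] 0) (𝓝 1) := by
    have : Continuous fun y : ℝ => Complex.exp (-(2 * π * Complex.I * y * η)) := by fun_prop
    have := this.tendsto 0
    simp only [Complex.ofReal_zero, mul_zero, zero_mul, neg_zero, Complex.exp_zero] at this
    exact this.mono_left nhdsWithin_le_nhds
  have h3 := h2.mul h1
  rw [one_mul] at h3
  refine h3.congr fun y => ?_
  rw [mul_left_comm, ← integral_const_mul, invPhiFT]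
  congr 2
  funext t
  rw [invPhiKer, ← mul_assoc, ← Complex.exp_add]
  congr 2
  push_cast
  linear_combination (2 * π * y * (t - η * Complex.I)) * Complex.I_sq

theorem ratioFn_eq_exp {bb : ℝ} (hbb : 0 < bb) (hb1 : bb < 1) {w : ℂ} (hw : w.im < 0)
    (hwQ : -((bb + bb⁻¹) / 2) < w.im) :
    ratioFn bb w = Complex.exp (Complex.I * π * (1 / 4 + (bb ^ 2 + (bb⁻¹) ^ 2) / 12)) := by
  obtain ⟨R, hR⟩ := ratioFn_const hbb hb1
  rw [hR w hw hwQ]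
  have hbi := inv_pos.mpr hbb
  have hb : (bb : ℂ) ≠ 0 := by exact_mod_cast hbb.ne'
  have hp : (π : ℂ) ≠ 0 := by exact_mod_cast Real.pi_ne_zero
  have hη : 0 < (bb + bb⁻¹) / 4 := by linarith
  have hηQ : (bb + bb⁻¹) / 4 < (bb + bb⁻¹) / 2 := by linarith
  have hzim : |(((bb⁻¹ - bb) / 2 : ℝ) * Complex.I : ℂ).im| < (bb + bb⁻¹) / 2 := by
    simpa using abs_sub_inv_div_two_lt hbb
  have hE : Tendsto (fun y : ℝ => Complex.exp (-π * (bb + bb⁻¹) * (-(y : ℂ) * Complex.I)))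
      (𝓝[>] 0) (𝓝 1) := by
    have : Continuous fun y : ℝ => Complex.exp (-π * (bb + bb⁻¹) * (-(y : ℂ) * Complex.I)) := by
      fun_prop
    have := this.tendsto 0
    simp only [Complex.ofReal_zero, mul_zero, zero_mul, neg_zero, Complex.exp_zero] at this
    exact this.mono_left nhdsWithin_le_nhds
  have hlim := ((tendsto_mul_invPhiFT hbb hη hηQ).mul hE).mul
    ((tendsto_one_sub_exp_div bb).mul
      ((continuousAt_PhiS_vertical hbb hzim).inv₀ (PhiS_ne_zero _ _)))
  have hconst : Tendsto (fun _ : ℝ => R) (𝓝[>] 0) (𝓝 R) := tendsto_const_nhds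
  have hRval := tendsto_nhds_unique (hconst.congr' (by
    filter_upwards [self_mem_nhdsWithin, nhdsWithin_le_nhds (eventually_lt_nhds hη),
      nhdsWithin_le_nhds (eventually_lt_nhds hbi)] with y hy h1 h2
    rw [mem_Ioi] at hy
    have hy' : (y : ℂ) ≠ 0 := by exact_mod_cast hy.ne'
    have him : (-(y : ℂ) * Complex.I).im = -y := by simp
    rw [← hR (-(y : ℂ) * Complex.I) (by rw [him]; linarith) (by rw [him]; linarith),
      ratioFn_eq hbb (η := (bb + bb⁻¹) / 4) (by rw [him]; linarith) (by rw [him]; linarith) hηQ]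
    have f1 := PhiS_sub_add_cB hbb (w := -(y : ℂ) * Complex.I) (by rw [him]; linarith)
      (by rw [him]; linarith)
    have e1 : -(y : ℂ) * Complex.I - Complex.I * bb + cB bb =
        -(y : ℂ) * Complex.I + ((bb⁻¹ - bb) / 2 : ℝ) * Complex.I := by
      rw [cB]
      push_cast
      ring
    rw [e1] at f1
    have n1 := PhiS_ne_zero bb (-(y : ℂ) * Complex.I + ((bb⁻¹ - bb) / 2 : ℝ) * Complex.I)
    have n2 := PhiS_ne_zero bb (-(y : ℂ) * Complex.I + cB bb)
    have hinv : (1 - Complex.exp (2 * π * bb * (-(y : ℂ) * Complex.I))) *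
        (PhiS bb (-(y : ℂ) * Complex.I + ((bb⁻¹ - bb) / 2 : ℝ) * Complex.I))⁻¹ =
        (PhiS bb (-(y : ℂ) * Complex.I + cB bb))⁻¹ := by
      rw [mul_inv_eq_iff_eq_mul₀ n1, f1]
      linear_combination (-(1 - Complex.exp (2 * π * bb * (-(y : ℂ) * Complex.I)))) *
        inv_mul_cancel₀ n2
    rw [← hinv]
    field_simp)) hlim
  rw [hRval, PhiS_sub_inv_eq hbb, mul_inv, ← Complex.exp_neg]
  have e : Complex.exp (Complex.I * π * (1 / 4 + (bb ^ 2 + (bb⁻¹) ^ 2) / 12)) =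
      Complex.exp (π / 2 * Complex.I) * Complex.exp (-(Complex.I * π * (1 / 4 - (bb ^ 2 + (bb⁻¹) ^ 2) / 12))) := by
    rw [← Complex.exp_add]
    congr 1
    ring
  rw [e, Complex.exp_pi_div_two_mul_I]
  field_simp

theorem continuousAt_contourHeight {b₀ : ℝ} (hb₀ : 0 < b₀) : ContinuousAt contourHeight b₀ := by
  have h : ContinuousAt (fun bb : ℝ => π * min bb bb⁻¹ / 2) b₀ :=
    (continuousAt_const.mul (continuousAt_id.min (continuousAt_inv₀ hb₀.ne'))).div_const 2
  exact h

theorem continuousAt_kerBound {b₀ : ℝ} (hb₀ : 0 < b₀) : ContinuousAt kerBound b₀ := by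
  have hc := continuousAt_contourHeight hb₀
  have h1 := contourHeight_pos hb₀
  have h2 := sin_contourHeight_mul_pos hb₀
  have h3 := sin_contourHeight_div_pos hb₀
  have h : ContinuousAt (fun bb : ℝ => 1 / (contourHeight bb * Real.sin (contourHeight bb * bb) *
      Real.sin (contourHeight bb / bb))) b₀ := by
    refine ContinuousAt.div continuousAt_const ((hc.mul ?_).mul ?_) (by positivity)
    · exact Real.continuous_sin.continuousAt.comp (hc.mul continuousAt_id)
    · exact Real.continuous_sin.continuousAt.comp (hc.div continuousAt_id hb₀.ne')
  exact h

theorem continuousAt_stripBound {b₀ Y : ℝ} (hb₀ : 0 < b₀) (hY : Y < (b₀ + b₀⁻¹) / 2) :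
    ContinuousAt (fun bb => stripBound bb Y) b₀ := by
  have h : ContinuousAt (fun bb : ℝ => kerBound bb * (2 / (bb + bb⁻¹ - 2 * Y))) b₀ :=
    (continuousAt_kerBound hb₀).mul (continuousAt_const.div
      ((continuousAt_id.add (continuousAt_inv₀ hb₀.ne')).sub continuousAt_const)
      (show 0 < b₀ + b₀⁻¹ - 2 * Y by linarith).ne')
  exact Real.continuous_exp.continuousAt.comp h

theorem continuousAt_phiKer_param {b₀ : ℝ} (hb₀ : 0 < b₀) {z : ℝ → ℂ} (hz : ContinuousAt z b₀)
    (t : ℝ) :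
    ContinuousAt (fun bb => phiKer bb (z bb) (t + contourHeight bb * Complex.I)) b₀ := by
  have hc : ContinuousAt (fun bb : ℝ => (t + contourHeight bb * Complex.I : ℂ)) b₀ := by
    have := Complex.continuous_ofReal.continuousAt.comp (continuousAt_contourHeight hb₀)
    exact continuousAt_const.add (this.mul continuousAt_const)
  have hb : ContinuousAt (fun bb : ℝ => (bb : ℂ)) b₀ := Complex.continuous_ofReal.continuousAt
  have hb₀' : (b₀ : ℂ) ≠ 0 := by exact_mod_cast hb₀.ne'
  refine ContinuousAt.div ?_ ?_ (contour_den_ne_zero hb₀ t)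
  · exact Complex.continuous_exp.continuousAt.comp ((continuousAt_const.mul hz).mul hc)
  · refine ((continuousAt_const.mul ?_).mul ?_).mul hc
    · exact Complex.continuous_sinh.continuousAt.comp (hc.mul hb)
    · exact Complex.continuous_sinh.continuousAt.comp (hc.div hb hb₀')

/-- Joint continuity of `log Φ_𝖻(z)` in the parameter `𝖻` and the argument `z`. -/
theorem continuousAt_logPhi_param {b₀ : ℝ} (hb₀ : 0 < b₀) {z : ℝ → ℂ} (hz : ContinuousAt z b₀)
    (hzb : |(z b₀).im| < (b₀ + b₀⁻¹) / 2) : ContinuousAt (fun bb => logPhi bb (z bb)) b₀ := by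
  have hδ : 0 < (b₀ + b₀⁻¹ - 2 * |(z b₀).im|) / 2 := by linarith
  have hexp : ContinuousAt (fun bb => kerBound bb *
      Real.exp (2 * contourHeight bb * (z bb).re)) b₀ :=
    (continuousAt_kerBound hb₀).mul (Real.continuous_exp.continuousAt.comp
      ((continuousAt_const.mul (continuousAt_contourHeight hb₀)).mul
        (Complex.continuous_re.continuousAt.comp hz)))
  have hdec : ContinuousAt (fun bb => bb + bb⁻¹ - 2 * |(z bb).im|) b₀ :=
    (continuousAt_id.add (continuousAt_inv₀ hb₀.ne')).sub
      (continuousAt_const.mul (Complex.continuous_im.continuousAt.comp hz).abs)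
  have e1 := hexp.eventually (eventually_lt_nhds (lt_add_one _))
  have e2 := hdec.eventually (eventually_gt_nhds (show (b₀ + b₀⁻¹ - 2 * |(z b₀).im|) / 2 < _ by
    linarith))
  refine tendsto_integral_filter_of_dominated_convergence
    (fun t => (kerBound b₀ * Real.exp (2 * contourHeight b₀ * (z b₀).re) + 1) *
      Real.exp (-((b₀ + b₀⁻¹ - 2 * |(z b₀).im|) / 2) * |t|)) ?_ ?_
    ((integrable_exp_neg_mul_abs hδ).const_mul _) ?_
  · filter_upwards [e2, eventually_gt_nhds hb₀] with bb h2 hbb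
    exact (integrable_phiKer hbb (by linarith)).aestronglyMeasurable
  · filter_upwards [e1, e2, eventually_gt_nhds hb₀] with bb h1 h2 hbb
    refine Eventually.of_forall fun t => (norm_phiKer_contour_le hbb _ t).trans ?_
    refine mul_le_mul h1.le ?_ (Real.exp_nonneg _) ?_
    · rw [Real.exp_le_exp]
      nlinarith [abs_nonneg t]
    · have := kerBound_pos hb₀
      positivity
  · exact Eventually.of_forall fun t => continuousAt_phiKer_param hb₀ hz t

theorem continuousAt_PhiS_param {b₀ : ℝ} (hb₀ : 0 < b₀) {z : ℝ → ℂ} (hz : ContinuousAt z b₀)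
    (hzb : |(z b₀).im| < (b₀ + b₀⁻¹) / 2) : ContinuousAt (fun bb => PhiS bb (z bb)) b₀ := by
  simp only [PhiS_eq_exp_logPhi]
  exact Complex.continuous_exp.continuousAt.comp (continuousAt_logPhi_param hb₀ hz hzb)

theorem continuousAt_invPhiFT_param {b₀ : ℝ} (hb₀ : 0 < b₀) {w : ℂ} (hw : w.im < 0) {η : ℝ}
    (hwη : -w.im < η) (hηQ : η < (b₀ + b₀⁻¹) / 2) :
    ContinuousAt (fun bb => invPhiFT bb η w) b₀ := by
  have hη : 0 < η := by linarith
  have hδ : 0 < 2 * π * min (-w.im) (η + w.im) := by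
    have : 0 < min (-w.im) (η + w.im) := lt_min (by linarith) (by linarith)
    positivity
  have hQ : ContinuousAt (fun bb : ℝ => (bb + bb⁻¹) / 2) b₀ :=
    (continuousAt_id.add (continuousAt_inv₀ hb₀.ne')).div_const 2
  have e1 := (continuousAt_stripBound hb₀ hηQ).eventually (eventually_lt_nhds (lt_add_one _))
  have e2 := hQ.eventually (eventually_gt_nhds hηQ)
  refine tendsto_integral_filter_of_dominated_convergence
    (fun t => (stripBound b₀ η + 1) * Real.exp (2 * π * η * w.re) *
      Real.exp (-(2 * π * min (-w.im) (η + w.im)) * |t|)) ?_ ?_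
    ((integrable_exp_neg_mul_abs hδ).const_mul _) ?_
  · filter_upwards [e2, eventually_gt_nhds hb₀] with bb h2 hbb
    exact (integrable_invPhiKer hbb hw hwη h2).aestronglyMeasurable
  · filter_upwards [e1, e2, eventually_gt_nhds hb₀] with bb h1 h2 hbb
    refine Eventually.of_forall fun t => (norm_invPhiKer_le hbb hη le_rfl h2 w t).trans ?_
    gcongr
  · refine Eventually.of_forall fun t => ?_
    exact continuousAt_const.mul ((continuousAt_PhiS_param hb₀ continuousAt_const
      (by simpa [abs_of_pos hη] using hηQ)).inv₀ (PhiS_ne_zero _ _))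

theorem invPhiFT_inv_param (bb η : ℝ) (w : ℂ) : invPhiFT bb⁻¹ η w = invPhiFT bb η w := by
  simp only [invPhiFT, invPhiKer, PhiS_inv_param]

theorem invPhiFT_eq_PhiS_of_lt_one {bb : ℝ} (hbb : 0 < bb) (hb1 : bb < 1) {w : ℂ} (hw : w.im < 0)
    {η : ℝ} (hwη : -w.im < η) (hηQ : η < (bb + bb⁻¹) / 2) :
    invPhiFT bb η w = Complex.exp (Complex.I * π * (1 / 4 + (bb ^ 2 + (bb⁻¹) ^ 2) / 12)) *
      Complex.exp (π * (bb + bb⁻¹) * w) * PhiS bb (w + cB bb) := by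
  rw [← ratioFn_eq_exp hbb hb1 hw (by linarith), ratioFn_eq hbb hw hwη hηQ]
  have n := PhiS_ne_zero bb (w + cB bb)
  have e : Complex.exp (-π * (bb + bb⁻¹) * w) * Complex.exp (π * (bb + bb⁻¹) * w) = 1 := by
    rw [← Complex.exp_add, ← Complex.exp_zero]
    congr 1
    ring
  linear_combination (-invPhiFT bb η w) * e - invPhiFT bb η w *
    Complex.exp (-π * (bb + bb⁻¹) * w) * Complex.exp (π * (bb + bb⁻¹) * w) * inv_mul_cancel₀ n

/-- The Fourier transform of `1 / Φ_𝖻`. -/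
theorem invPhiFT_eq_PhiS {bb : ℝ} (hbb : 0 < bb) {w : ℂ} (hw : w.im < 0) {η : ℝ}
    (hwη : -w.im < η) (hηQ : η < (bb + bb⁻¹) / 2) :
    invPhiFT bb η w = Complex.exp (Complex.I * π * (1 / 4 + (bb ^ 2 + (bb⁻¹) ^ 2) / 12)) *
      Complex.exp (π * (bb + bb⁻¹) * w) * PhiS bb (w + cB bb) := by
  rcases lt_trichotomy bb 1 with h | h | h
  · exact invPhiFT_eq_PhiS_of_lt_one hbb h hw hwη hηQ
  · subst h
    have hcB : ContinuousAt (fun bb : ℝ => w + cB bb) 1 := by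
      unfold cB
      have : ContinuousAt (fun bb : ℝ => ((bb⁻¹ : ℝ) : ℂ)) 1 :=
        Complex.continuous_ofReal.continuousAt.comp (continuousAt_inv₀ one_ne_zero)
      fun_prop
    have hinv : ContinuousAt (fun bb : ℝ => ((bb⁻¹ : ℝ) : ℂ)) 1 :=
      Complex.continuous_ofReal.continuousAt.comp (continuousAt_inv₀ one_ne_zero)
    have hR : ContinuousAt (fun bb : ℝ =>
        Complex.exp (Complex.I * π * (1 / 4 + (bb ^ 2 + (bb⁻¹ : ℝ) ^ 2) / 12)) *
        Complex.exp (π * (bb + (bb⁻¹ : ℝ)) * w) * PhiS bb (w + cB bb)) 1 := by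
      refine ContinuousAt.mul (by fun_prop) (continuousAt_PhiS_param one_pos hcB ?_)
      rw [Complex.add_im, cB_im, abs_lt]
      constructor <;> linarith
    have hL := continuousAt_invPhiFT_param one_pos hw hwη hηQ
    refine tendsto_nhds_unique (hL.tendsto.mono_left (nhdsWithin_le_nhds (s := Iio 1)))
      ((hR.tendsto.mono_left (nhdsWithin_le_nhds (s := Iio 1))).congr' ?_)
    filter_upwards [self_mem_nhdsWithin, nhdsWithin_le_nhds (eventually_gt_nhds one_pos)]
      with bb h1 h2
    refine (invPhiFT_eq_PhiS_of_lt_one h2 h1 hw hwη (hηQ.trans_le ?_)).symm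
    have : bb * bb⁻¹ = 1 := mul_inv_cancel₀ h2.ne'
    have := inv_pos.mpr h2
    norm_num
    nlinarith [sq_nonneg (bb - bb⁻¹)]
  · have := invPhiFT_eq_PhiS_of_lt_one (inv_pos.mpr hbb) (inv_lt_one_of_one_lt₀ h) hw hwη
      (by rwa [inv_inv, add_comm])
    rw [invPhiFT_inv_param, PhiS_inv_param, cB_inv, inv_inv] at this
    rw [this, add_comm ((bb⁻¹ : ℝ) : ℂ), add_comm (((bb⁻¹ : ℝ) : ℂ) ^ 2)]

theorem Phi_eq_PhiS {bb : ℝ} {z : ℂ} (hz : |z.im| < (bb + bb⁻¹) / 2) : Phi bb z = PhiS bb z := by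
  rw [abs_lt] at hz
  rw [Phi, if_neg (by linarith), if_neg (by linarith)]

theorem add_inv_eq_cB (bb : ℝ) : (bb + (bb⁻¹ : ℝ) : ℂ) = -2 * Complex.I * cB bb := by
  rw [cB]
  linear_combination (bb + (bb⁻¹ : ℝ) : ℂ) * Complex.I_sq

theorem sq_add_inv_sq_eq_cB {bb : ℝ} (hbb : 0 < bb) :
    (bb ^ 2 + (bb⁻¹ : ℝ) ^ 2 : ℂ) = -4 * cB bb ^ 2 - 2 := by
  have hb : (bb * (bb⁻¹ : ℝ) : ℂ) = 1 := by exact_mod_cast mul_inv_cancel₀ hbb.ne'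
  rw [cB]
  linear_combination (bb + (bb⁻¹ : ℝ) : ℂ) ^ 2 * Complex.I_sq - 2 * hb

theorem psiT_eq_exp_mul_psiBar {bb : ℝ} (hbb : 0 < bb) {a c : ℝ} (ha : 0 < a) (hc : 0 < c)
    (hb : 0 < 1 / 2 - a - c) (x : ℝ) :
    psiT bb a c x =
      Complex.exp (π * Complex.I / 12) * psiBar bb (1 / 2 - a - c) c ((-x : ℝ) : ℂ) := by
  have hQ : 0 < bb + bb⁻¹ := add_pos hbb (inv_pos.mpr hbb)
  set η := (bb + bb⁻¹) * (a + c) with hη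
  set w : ℂ := -2 * cB bb * a - x with hw
  have hwim : w.im = -((bb + bb⁻¹) * a) := by
    have : w = (-x : ℝ) + (-((bb + bb⁻¹) * a) : ℝ) * Complex.I := by
      rw [hw, cB_eq]
      push_cast
      ring
    rw [this]
    simp
  have hη0 : 0 < η := by positivity
  have hηQ : η < (bb + bb⁻¹) / 2 := by
    rw [hη]
    nlinarith
  have harg : ∀ t : ℝ, (t - 2 * cB bb * (a + c) : ℂ) = t + (-η : ℝ) * Complex.I := by
    intro t
    rw [hη, cB_eq]
    push_cast
    ring
  have hker : ∀ t : ℝ, psiF bb a c t * Complex.exp (-2 * π * Complex.I * x * t) =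
      Complex.exp (-4 * π * Complex.I * cB bb * (a + c) * (cB bb * a + x)) *
      Complex.exp (-π * Complex.I * (cB bb) ^ 2 * (4 * (a - c) + 1) / 6) *
      invPhiKer bb w (t + (-η : ℝ) * Complex.I) := by
    intro t
    have hexp : Complex.exp (-4 * π * Complex.I * cB bb * a * (t - cB bb * (a + c))) *
        Complex.exp (-2 * π * Complex.I * x * t) =
        Complex.exp (-4 * π * Complex.I * cB bb * (a + c) * (cB bb * a + x)) *
        Complex.exp (2 * π * Complex.I * w * (t - 2 * cB bb * (a + c))) := by
      rw [← Complex.exp_add, ← Complex.exp_add, hw]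
      congr 1
      ring
    rw [psiF, invPhiKer, ← harg, Phi_eq_PhiS (by simpa [harg, abs_of_pos hη0] using hηQ)]
    linear_combination ((PhiS bb (t - 2 * cB bb * (a + c)))⁻¹ *
      Complex.exp (-π * Complex.I * (cB bb) ^ 2 * (4 * (a - c) + 1) / 6)) * hexp
  have hPhi : (((-x : ℝ) : ℂ) + 2 * cB bb * (((1 / 2 - a - c : ℝ) : ℂ) + c)) = w + cB bb := by
    rw [hw]
    push_cast
    ring
  rw [psiT]
  simp_rw [hker]
  rw [integral_const_mul, show ∫ t : ℝ, invPhiKer bb w (t + (-η : ℝ) * Complex.I) =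
    invPhiFT bb η w from rfl, invPhiFT_eq_PhiS hbb (by rw [hwim]; nlinarith)
    (by rw [hwim, hη]; nlinarith) hηQ, psiBar, hPhi, Phi_eq_PhiS (by
      rw [Complex.add_im, cB_im, hwim, abs_lt]
      constructor <;> nlinarith), sq_add_inv_sq_eq_cB hbb, add_inv_eq_cB]
  have hexp : Complex.exp (-4 * π * Complex.I * cB bb * (a + c) * (cB bb * a + x)) *
      Complex.exp (-π * Complex.I * (cB bb) ^ 2 * (4 * (a - c) + 1) / 6) *
      (Complex.exp (Complex.I * π * (1 / 4 + (-4 * cB bb ^ 2 - 2) / 12)) *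
      Complex.exp (π * (-2 * Complex.I * cB bb) * w)) =
      Complex.exp (π * Complex.I / 12) *
      Complex.exp (-4 * π * Complex.I * cB bb * (1 / 2 - a - c : ℝ) *
        ((-x : ℝ) + cB bb * ((1 / 2 - a - c : ℝ) + c))) *
      Complex.exp (π * Complex.I * (cB bb) ^ 2 * (4 * ((1 / 2 - a - c : ℝ) - c) + 1) / 6) := by
    simp only [← Complex.exp_add]
    congr 1
    rw [hw]
    push_cast
    ring
  linear_combination PhiS bb (w + cB bb) * hexp

/-- Equality (7) of the paper: `ψ̃_{a,c}(x) = e^{iπ/12} ψ̄_{b,c}(-x)`, equivalently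
`ψ̄_{a,c}(x) = e^{-iπ/12} ψ̃_{b,c}(-x)`, with `b = 1/2 - a - c`. -/
theorem psiT_eq_psiBar (bb : ℝ) (hbb : 0 < bb) (a c : ℝ)
    (ha : 0 < a) (hc : 0 < c) (hb : 0 < 1 / 2 - a - c) (x : ℝ) :
    psiT bb a c x = Complex.exp (π * Complex.I / 12) * psiBar bb (1 / 2 - a - c) c ((-x : ℝ) : ℂ) ∧
    psiBar bb a c (x : ℂ) = Complex.exp (-π * Complex.I / 12) * psiT bb (1 / 2 - a - c) c (-x) := by
  refine ⟨psiT_eq_exp_mul_psiBar hbb ha hc hb x, ?_⟩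
  have e : 1 / 2 - (1 / 2 - a - c) - c = a := by ring
  rw [psiT_eq_exp_mul_psiBar hbb hb hc (by rw [e]; exact ha), e, neg_neg, ← mul_assoc,
    ← Complex.exp_add, show -π * Complex.I / 12 + π * Complex.I / 12 = (0 : ℂ) by ring,
    Complex.exp_zero, one_mul]
end
end

section
/- For any Schwartz function f on ℝ and all real x, y, one has (W(Ff))(x, y) = (Wf)(−y, x) and (W(F⁻¹f))(x, y) = (Wf)(y, −x). -/
open Real MeasureTheory

noncomputable section

/-- The Weil–Gel'fand–Zak transform: `(Wf)(x,y) = e^{πixy} Σ_{m∈ℤ} f(x+m) e^{2πimy}`. -/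
def WGZ (f : ℝ → ℂ) (x y : ℝ) : ℂ :=
  Complex.exp (π * Complex.I * x * y) *
    ∑' m : ℤ, f (x + m) * Complex.exp (2 * π * Complex.I * m * y)

/-- The Fourier transform `(Ff)(x) = ∫_ℝ f(y) e^{2πixy} dy`. -/
def FourT (f : ℝ → ℂ) (x : ℝ) : ℂ := ∫ y : ℝ, f y * Complex.exp (2 * π * Complex.I * x * y)

/-- The inverse Fourier transform `(F⁻¹f)(x) = ∫_ℝ f(y) e^{-2πixy} dy`. -/
def FourTInv (f : ℝ → ℂ) (x : ℝ) : ℂ := ∫ y : ℝ, f y * Complex.exp (-2 * π * Complex.I * x * y)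

open scoped FourierTransform in
theorem FourTInv_eq_fourier (f : SchwartzMap ℝ ℂ) : FourTInv ⇑f = ⇑(𝓕 f : SchwartzMap ℝ ℂ) := by
  funext x
  rw [SchwartzMap.fourier_coe, Real.fourier_real_eq_integral_exp_smul, FourTInv]
  congr 1 with y
  rw [smul_eq_mul, mul_comm]
  congr 2
  push_cast
  ring

theorem FourT_eq_FourTInv_neg (f : ℝ → ℂ) (x : ℝ) : FourT f x = FourTInv f (-x) := by
  simp [FourT, FourTInv]

/-- The transform `W` intertwines the reflection of `ℝ` with the reflection of `ℝ²`. -/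
theorem WGZ_comp_neg (f : ℝ → ℂ) (x y : ℝ) :
    WGZ (fun t => f (-t)) x y = WGZ f (-x) (-y) := by
  unfold WGZ
  congr 1
  · simp
  · rw [← (Equiv.neg ℤ).tsum_eq]
    congr 1 with m
    simp [add_comm]

open scoped FourierTransform in
/-- Modulating a function translates its Fourier transform. -/
theorem fourier_mul_exp (f : ℝ → ℂ) (x w : ℝ) :
    𝓕 (fun t : ℝ => f t * Complex.exp (-(2 * π * Complex.I * x * t))) w = 𝓕 f (w + x) := by
  rw [Real.fourier_real_eq_integral_exp_smul, Real.fourier_real_eq_integral_exp_smul]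
  congr 1 with t
  rw [smul_eq_mul, smul_eq_mul, mul_left_comm, ← Complex.exp_add, mul_comm]
  congr 2
  push_cast
  ring

open scoped FourierTransform in
/-- Poisson summation for the modulated function `t ↦ f t * exp (-2πixt)`. -/
theorem tsum_mul_exp_eq_tsum_fourier (f : SchwartzMap ℝ ℂ) (x y : ℝ) :
    ∑' n : ℤ, f (y + n) * Complex.exp (-(2 * π * Complex.I * x * (y + n : ℝ))) =
      ∑' n : ℤ, (𝓕 f : SchwartzMap ℝ ℂ) (x + n) * Complex.exp (2 * π * Complex.I * n * y) := by
  let g : ℝ → ℂ := fun t => f t * Complex.exp (-(2 * π * Complex.I * x * t))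
  have hg_norm (t : ℝ) : ‖g t‖ = ‖f t‖ := by simp [g, Complex.norm_exp]
  have hg_fourier : 𝓕 g = ⇑(SchwartzMap.compSubConstCLM ℂ (-x) (𝓕 f)) := by
    funext w
    simp [g, fourier_mul_exp, SchwartzMap.fourier_coe]
  have hg_cont : Continuous g := f.continuous.mul (by fun_prop)
  have hg_decay : g =O[Filter.cocompact ℝ] fun t : ℝ => |t| ^ (-2 : ℝ) :=
    (Asymptotics.isBigO_of_le _ fun t => (hg_norm t).le).trans (f.isBigO_cocompact_rpow (-2))
  have hg_fourier_decay : 𝓕 g =O[Filter.cocompact ℝ] fun t : ℝ => |t| ^ (-2 : ℝ) := by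
    rw [hg_fourier]
    exact SchwartzMap.isBigO_cocompact_rpow _ (-2)
  refine (Real.tsum_eq_tsum_fourier_of_rpow_decay hg_cont one_lt_two hg_decay
    hg_fourier_decay y).trans ?_
  congr 1 with n
  rw [fourier_mul_exp, fourier_coe_apply, SchwartzMap.fourier_coe, add_comm]
  simp

theorem WGZ_FourTInv (f : SchwartzMap ℝ ℂ) (x y : ℝ) :
    WGZ (FourTInv ⇑f) x y = WGZ ⇑f y (-x) := by
  rw [FourTInv_eq_fourier, WGZ, ← tsum_mul_exp_eq_tsum_fourier, WGZ, ← tsum_mul_left,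
    ← tsum_mul_left]
  congr 1 with n
  rw [mul_left_comm, ← Complex.exp_add, mul_left_comm, ← Complex.exp_add]
  congr 2
  push_cast
  ring

/-- Lemma 1, eq. (21) of the paper: `(WFf)(x,y) = (Wf)(-y,x)` and `(WF⁻¹f)(x,y) = (Wf)(y,-x)`. -/
theorem WGZ_fourier (f : SchwartzMap ℝ ℂ) (x y : ℝ) :
    WGZ (FourT ⇑f) x y = WGZ ⇑f (-y) x ∧ WGZ (FourTInv ⇑f) x y = WGZ ⇑f y (-x) := by
  refine ⟨?_, WGZ_FourTInv f x y⟩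
  rw [funext (FourT_eq_FourTInv_neg f), WGZ_comp_neg, WGZ_FourTInv, neg_neg]
end
end

section
/- For any Schwartz function f on ℝ and all real x, y, one has (W(Gf))(x, y) = (Wf)(x, x + y + 1/2) · e^{−πix/2} and (W(G⁻¹f))(x, y) = (Wf)(x, y − x − 1/2) · e^{πix/2}. -/
open Real MeasureTheory

noncomputable section

/-- The Gaussian multiplication operator `(Gf)(x) = e^{πix²} f(x)`. -/
def GaussOp (f : ℝ → ℂ) (x : ℝ) : ℂ := Complex.exp (π * Complex.I * x ^ 2) * f x

/-- The inverse Gaussian multiplication operator `(G⁻¹f)(x) = e^{-πix²} f(x)`. -/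
def GaussOpInv (f : ℝ → ℂ) (x : ℝ) : ℂ := Complex.exp (-π * Complex.I * x ^ 2) * f x

/-- Multiplication by the Gaussian `e^{πist²}` with `s` an integer shears the Weil–Gel'fand–Zak
transform. -/
theorem WGZ_int_gauss_mul (f : ℝ → ℂ) (s : ℤ) (x y : ℝ) :
    WGZ (fun t => Complex.exp (s * (π * Complex.I * t ^ 2)) * f t) x y =
      WGZ f x (y + s * (x + 1 / 2)) * Complex.exp (-(s * (π * Complex.I * x / 2))) := by
  unfold WGZ
  rw [mul_right_comm (Complex.exp _), ← tsum_mul_left, ← tsum_mul_left]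
  refine tsum_congr fun m => ?_
  obtain ⟨k, hk⟩ := (Int.even_mul_pred_self m).two_dvd
  have hk' : (m : ℂ) * (m - 1) = 2 * k := by exact_mod_cast hk
  have key : Complex.exp (π * Complex.I * x * y) *
      (Complex.exp (s * (π * Complex.I * (x + m : ℝ) ^ 2)) *
        Complex.exp (2 * π * Complex.I * m * y)) =
      Complex.exp (π * Complex.I * x * (y + s * (x + 1 / 2) : ℝ)) *
        Complex.exp (-(s * (π * Complex.I * x / 2))) *
        Complex.exp (2 * π * Complex.I * m * (y + s * (x + 1 / 2) : ℝ)) := by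
    simp only [← Complex.exp_add]
    refine Complex.exp_eq_exp_iff_exists_int.2 ⟨s * k, ?_⟩
    push_cast
    linear_combination s * π * Complex.I * hk'
  linear_combination f (x + m) * key

/-- Lemma 1, eq. (22) of the paper: `(WGf)(x,y) = (Wf)(x, x+y+1/2) e^{-πix/2}` and
`(WG⁻¹f)(x,y) = (Wf)(x, y-x-1/2) e^{πix/2}`. -/
theorem WGZ_gauss (f : SchwartzMap ℝ ℂ) (x y : ℝ) :
    WGZ (GaussOp ⇑f) x y = WGZ ⇑f x (x + y + 1 / 2) * Complex.exp (-π * Complex.I * x / 2) ∧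
    WGZ (GaussOpInv ⇑f) x y = WGZ ⇑f x (y - x - 1 / 2) * Complex.exp (π * Complex.I * x / 2) := by
  constructor
  · convert WGZ_int_gauss_mul f 1 x y using 2
    · funext t
      simp [GaussOp]
    · congr 1
      push_cast
      ring
    · congr 1
      push_cast
      ring
  · convert WGZ_int_gauss_mul f (-1) x y using 2
    · funext t
      simp [GaussOpInv]
    · congr 1
      push_cast
      ring
    · congr 1
      push_cast
      ring
end
end
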